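/- arXiv:1707.05218 — 2 statements merged into one kernel-verified Lean document; each statement's English description precedes it below -/
import Mathlib

section
/- Let a be a real number such that 3/2 − 2a is not a nonpositive integer and 4/3 − 2a is not a nonpositive integer. Then ₂F₁(a, a+1/2; 3/2−2a | −1/3) = (9/8)^{2a} · 2·Γ(3/2−2a)·Γ(4/3) / (√π · Γ(4/3−2a)), where the left-hand side is the absolutely convergent series ∑_{k≥0} (a)_k (a+1/2)_k / ((3/2−2a)_k k!) · (−1/3)^k. -/
open Polynomial Real

/-- The `k`-th term of the series `₂F₁(s/2, s/2 + 1/2; 3/2 - s | -1/3)`. -/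
noncomputable def seriesTerm (s : ℂ) (k : ℕ) : ℂ :=
  (ascPochhammer ℂ k).eval (s / 2) * (ascPochhammer ℂ k).eval (s / 2 + 1 / 2) /
    ((ascPochhammer ℂ k).eval (3 / 2 - s) * (Nat.factorial k : ℂ)) * (-1 / 3 : ℂ) ^ k

theorem seriesTerm_zero (s : ℂ) : seriesTerm s 0 = 1 := by simp [seriesTerm]

theorem seriesTerm_succ (s : ℂ) (k : ℕ) :
    seriesTerm s (k + 1) = seriesTerm s k *
      ((-1 / 3) * ((s / 2 + k) * (s / 2 + 1 / 2 + k) / ((3 / 2 - s + k) * (k + 1)))) := by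
  simp only [seriesTerm, ascPochhammer_succ_eval, Nat.factorial_succ, Nat.cast_mul, Nat.cast_succ,
    pow_succ, div_eq_mul_inv, mul_inv]
  ring

theorem eval_ascPochhammer_ne_zero {c : ℂ} (hc : ∀ k : ℕ, c ≠ -(k : ℂ)) (n : ℕ) :
    (ascPochhammer ℂ n).eval c ≠ 0 := by
  induction n with
  | zero => simp
  | succ n ih =>
    rw [ascPochhammer_succ_eval]
    exact mul_ne_zero ih fun h => hc n (eq_neg_of_add_eq_zero_left h)

theorem succ_mul_seriesTerm_succ {s : ℂ} (hs : ∀ k : ℕ, 1 / 2 - s ≠ -(k : ℂ)) (k : ℕ) :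
    ((k + 1 : ℕ) : ℂ) * (1 / 2 - s + (k + 1 : ℕ)) * seriesTerm s (k + 1) =
      (-1 / 3) * ((s / 2 + k) * (s / 2 + 1 / 2 + k)) * seriesTerm s k := by
  have h2 : 3 / 2 - s + k ≠ 0 := fun h => hs (k + 1) (by push_cast; linear_combination h)
  have h4 : (k : ℂ) + 1 ≠ 0 := by exact_mod_cast k.succ_ne_zero
  have e : 1 / 2 - s + ((k + 1 : ℕ) : ℂ) = 3 / 2 - s + k := by push_cast; ring
  rw [e, seriesTerm_succ, Nat.cast_succ]
  generalize 3 / 2 - s + (k : ℂ) = D at *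
  field_simp

theorem half_mul_seriesTerm_add_one {s : ℂ} (hs : ∀ k : ℕ, 1 / 2 - s ≠ -(k : ℂ)) (k : ℕ) :
    (s / 2) * (1 / 2 - s) * seriesTerm (s + 1) k =
      (s / 2 + k) * (1 / 2 - s + k) * seriesTerm s k := by
  induction k with
  | zero => simp [seriesTerm_zero]
  | succ k ih =>
    have h1 : 1 / 2 - s + k ≠ 0 := fun h => hs k (eq_neg_of_add_eq_zero_left h)
    have h4 : (k : ℂ) + 1 ≠ 0 := by exact_mod_cast k.succ_ne_zero
    have hsucc := succ_mul_seriesTerm_succ hs k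
    have e : 3 / 2 - (s + 1) + (k : ℂ) = 1 / 2 - s + k := by ring
    rw [Nat.cast_succ] at hsucc ⊢
    refine mul_left_cancel₀ h4 ?_
    calc _ = (k + 1) * (s / 2 * (1 / 2 - s) * seriesTerm (s + 1) k * ((-1 / 3) *
            (((s + 1) / 2 + k) * ((s + 1) / 2 + 1 / 2 + k) / ((3 / 2 - (s + 1) + k) * (k + 1))))) := by
          rw [seriesTerm_succ]; ring
      _ = (s / 2 + (k + 1)) * ((-1 / 3) * ((s / 2 + k) * (s / 2 + 1 / 2 + k)) * seriesTerm s k) := by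
          rw [ih, e]
          generalize 1 / 2 - s + (k : ℂ) = D at *
          field_simp
          ring
      _ = _ := by rw [← hsucc]; ring

theorem summable_of_tendsto_ratio {x ρ : ℕ → ℂ} {l : ℂ} (hl : ‖l‖ < 1)
    (hρ : Filter.Tendsto ρ Filter.atTop (nhds l)) (hx : ∀ᶠ n in Filter.atTop, x (n + 1) = x n * ρ n) :
    Summable x := by
  obtain ⟨r, hr, hr1⟩ := exists_between hl
  refine summable_of_ratio_norm_eventually_le hr1 ?_
  filter_upwards [hx, hρ.norm.eventually_le_const hr] with n hn hle
  rw [hn, norm_mul, mul_comm]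
  gcongr

theorem tendsto_add_div_add (a b : ℂ) :
    Filter.Tendsto (fun n : ℕ => (a + n) / (b + n)) Filter.atTop (nhds 1) := by
  simpa [add_comm] using tendsto_add_mul_div_add_mul_atTop_nhds a b (1 : ℂ) one_ne_zero

theorem summable_seriesTerm (s : ℂ) : Summable (seriesTerm s) := by
  refine summable_of_tendsto_ratio (l := -1 / 3)
    (ρ := fun k : ℕ => (-1 / 3) * ((s / 2 + k) * (s / 2 + 1 / 2 + k) / ((3 / 2 - s + k) * (k + 1))))
    (by norm_num) ?_ (Filter.Eventually.of_forall (seriesTerm_succ s))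
  have := (((tendsto_add_div_add (s / 2) (3 / 2 - s)).mul
    (tendsto_add_div_add (s / 2 + 1 / 2) 1)).const_mul (-1 / 3 : ℂ))
  simp only [mul_one] at this
  refine this.congr fun k => ?_
  rw [div_mul_div_comm, add_comm (1 : ℂ)]

theorem summable_mul_seriesTerm {s : ℂ} (hs : ∀ k : ℕ, 1 / 2 - s ≠ -(k : ℂ)) :
    Summable fun k : ℕ => k * (1 / 2 - s + k) * seriesTerm s k := by
  refine summable_of_tendsto_ratio (l := -1 / 3)
    (ρ := fun k : ℕ => (-1 / 3) * (((s / 2 + k) / (1 / 2 - s + k)) * ((s / 2 + 1 / 2 + k) / (0 + k))))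
    (by norm_num) ?_ ?_
  · simpa only [mul_one] using (((tendsto_add_div_add (s / 2) (1 / 2 - s)).mul
      (tendsto_add_div_add (s / 2 + 1 / 2) 0)).const_mul (-1 / 3 : ℂ))
  · filter_upwards [Filter.eventually_ge_atTop 1] with k hk
    have h0 : (k : ℂ) ≠ 0 := by exact_mod_cast (by omega : k ≠ 0)
    have h1 : 1 / 2 - s + k ≠ 0 := fun h => hs k (eq_neg_of_add_eq_zero_left h)
    rw [succ_mul_seriesTerm_succ hs, zero_add]
    generalize 1 / 2 - s + (k : ℂ) = D at *
    field_simp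

theorem tsum_seriesTerm_zero : ∑' k, seriesTerm 0 k = 1 := by
  rw [tsum_eq_single 0 fun k hk => by simp [seriesTerm, ascPochhammer_ne_zero_eval_zero _ hk],
    seriesTerm_zero]

theorem tsum_seriesTerm_add_one {s : ℂ} (hs : ∀ k : ℕ, 1 / 2 - s ≠ -(k : ℂ)) :
    (1 / 2 - s) * ∑' k, seriesTerm (s + 1) k = 9 / 8 * (1 / 3 - s) * ∑' k, seriesTerm s k := by
  rcases eq_or_ne s 0 with rfl | h0
  · have ho : seriesTerm (0 + 1) = fun k => (-1 / 3 : ℂ) ^ k := by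
      funext k
      have h := eval_ascPochhammer_ne_zero (c := 1 / 2) (by simpa using hs) k
      have hf : (Nat.factorial k : ℂ) ≠ 0 := by exact_mod_cast k.factorial_ne_zero
      have e1 : (3 / 2 - (0 + 1) : ℂ) = 1 / 2 := by norm_num
      have e2 : ((0 + 1) / 2 + 1 / 2 : ℂ) = 1 := by norm_num
      have e3 : ((0 + 1) / 2 : ℂ) = 1 / 2 := by norm_num
      rw [seriesTerm, e1, e2, e3, ascPochhammer_eval_one, div_self (mul_ne_zero h hf), one_mul]
    rw [tsum_seriesTerm_zero, ho, tsum_geometric_of_norm_lt_one (by norm_num)]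
    norm_num
  · set g : ℕ → ℂ := fun k => k * (1 / 2 - s + k) * seriesTerm s k
    have hsum : ∀ n, ∑ k ∈ Finset.range n, ((1 / 2 - s) * seriesTerm (s + 1) k
        - 9 / 8 * (1 / 3 - s) * seriesTerm s k) = -(3 / (2 * s)) * g n := by
      intro n
      induction n with
      | zero => simp [g]
      | succ n ih =>
        have key := half_mul_seriesTerm_add_one hs n
        have key' : (1 / 2 - s) * seriesTerm (s + 1) n =
            (2 / s) * ((s / 2 + n) * (1 / 2 - s + n) * seriesTerm s n) := by
          rw [← key]; field_simp
        have hg : g (n + 1) = _ := succ_mul_seriesTerm_succ hs n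
        rw [Finset.sum_range_succ, ih, hg, key']
        simp only [g]
        field_simp
        ring
    have hA := (summable_seriesTerm (s + 1)).hasSum.mul_left (1 / 2 - s)
    have hB := (summable_seriesTerm s).hasSum.mul_left (9 / 8 * (1 / 3 - s))
    have hl := (hA.sub hB).tendsto_sum_nat
    simp only [hsum] at hl
    have hg := (summable_mul_seriesTerm hs).tendsto_atTop_zero.const_mul (-(3 / (2 * s)))
    rw [mul_zero] at hg
    exact sub_eq_zero.1 (tendsto_nhds_unique hl hg)

theorem norm_half_add_le {s : ℂ} (hs : s.re ≤ 1) (k : ℕ) : ‖s / 2 + k‖ ≤ ‖3 / 2 - s + k‖ := by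
  have hk : (0 : ℝ) ≤ k := k.cast_nonneg
  rw [← sq_le_sq₀ (norm_nonneg _) (norm_nonneg _), Complex.sq_norm, Complex.sq_norm,
    Complex.normSq_apply, Complex.normSq_apply]
  have e1 : (s / 2 + k).re = s.re / 2 + k := by simp
  have e2 : (s / 2 + k).im = s.im / 2 := by simp
  have e3 : (3 / 2 - s + k).re = 3 / 2 - s.re + k := by simp
  have e4 : (3 / 2 - s + k).im = - s.im := by simp
  rw [e1, e2, e3, e4]
  nlinarith [mul_nonneg (by linarith : 0 ≤ 1 - s.re) (by linarith : 0 ≤ 3 / 2 - s.re / 2 + 2 * k),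
    sq_nonneg s.im]

theorem norm_seriesTerm_le {s : ℂ} (hs : s.re ≤ 1) {N : ℕ} (hN : ‖s / 2 + 1 / 2‖ ≤ N + 1) (k : ℕ) :
    ‖seriesTerm s k‖ ≤ ((k + N).choose N : ℝ) * (1 / 3) ^ k := by
  induction k with
  | zero => simp [seriesTerm_zero]
  | succ k ih =>
    have hpos : 0 < ‖3 / 2 - s + (k : ℂ)‖ := by
      rw [norm_pos_iff]
      intro h
      have := congrArg Complex.re h
      have hk : (0 : ℝ) ≤ k := k.cast_nonneg
      have e3 : (3 / 2 - s + k).re = 3 / 2 - s.re + k := by simp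
      rw [e3, Complex.zero_re] at this
      linarith
    have hk1 : (0 : ℝ) < k + 1 := by positivity
    have hnk : ‖(k : ℂ) + 1‖ = k + 1 := by
      rw [← Nat.cast_succ, Complex.norm_natCast, Nat.cast_succ]
    have hratio : ‖(-1 / 3 : ℂ) * ((s / 2 + k) * (s / 2 + 1 / 2 + k) / ((3 / 2 - s + k) * (k + 1)))‖
        ≤ (1 / 3) * ((N + 1 + k) / (k + 1)) := by
      rw [norm_mul, norm_div (_ * _), norm_mul (s / 2 + _), norm_mul (_ + _), hnk, mul_div_mul_comm]
      have a1 := norm_half_add_le hs k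
      have a2 : ‖s / 2 + 1 / 2 + (k : ℂ)‖ ≤ N + 1 + k :=
        (norm_add_le _ _).trans (by rw [Complex.norm_natCast]; gcongr)
      have a3 : ‖(-1 / 3 : ℂ)‖ = 1 / 3 := by norm_num
      rw [a3]
      gcongr
      calc _ ≤ 1 * ((N + 1 + k) / ((k : ℝ) + 1)) := by
            gcongr
            exact (div_le_one hpos).2 a1
        _ = _ := one_mul _
    have hch : ((k + 1 + N).choose N : ℝ) * (k + 1) = ((k + N).choose N : ℝ) * (N + 1 + k) := by
      have := Nat.choose_mul_succ_eq (k + N) N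
      have e : k + N + 1 - N = k + 1 := by omega
      rw [e] at this
      have e' : k + 1 + N = k + N + 1 := by omega
      rw [e']
      have h' := congrArg (Nat.cast : ℕ → ℝ) this
      push_cast at h'
      linarith
    rw [seriesTerm_succ, norm_mul]
    calc _ ≤ (((k + N).choose N : ℝ) * (1 / 3) ^ k) * ((1 / 3) * ((N + 1 + k) / (k + 1))) := by
          gcongr
      _ = ((k + N).choose N : ℝ) * (N + 1 + k) / (k + 1) * (1 / 3) ^ (k + 1) := by
          rw [pow_succ]; ring
      _ = _ := by rw [← hch, mul_div_cancel_right₀ _ hk1.ne']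

theorem norm_tsum_seriesTerm_le {s : ℂ} (hs : s.re ≤ 1) {N : ℕ} (hN : ‖s / 2 + 1 / 2‖ ≤ N + 1) :
    ‖∑' k, seriesTerm s k‖ ≤ (3 / 2) ^ (N + 1) := by
  have h3 : ‖(1 / 3 : ℝ)‖ < 1 := by norm_num
  have hsum : HasSum (fun k : ℕ => ((k + N).choose N : ℝ) * (1 / 3) ^ k) ((3 / 2) ^ (N + 1)) := by
    have h := hasSum_choose_mul_geometric_of_norm_lt_one N h3
    rwa [one_div ((1 - 1 / 3 : ℝ) ^ _), ← inv_pow, show (1 - 1 / 3 : ℝ)⁻¹ = 3 / 2 by norm_num] at h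
  exact tsum_of_norm_bounded hsum (norm_seriesTerm_le hs hN)

theorem differentiable_eval_ascPochhammer (k : ℕ) :
    Differentiable ℂ fun z : ℂ => (ascPochhammer ℂ k).eval z := Polynomial.differentiable _

theorem differentiableOn_tsum_seriesTerm :
    DifferentiableOn ℂ (fun s => ∑' k, seriesTerm s k) {s | s.re < 1} := by
  intro s hs
  obtain ⟨N, hN⟩ := exists_nat_gt ‖s / 2 + 1 / 2‖
  have hopen : IsOpen {z : ℂ | z.re < 1 ∧ ‖z / 2 + 1 / 2‖ < N} :=
    (isOpen_lt Complex.continuous_re continuous_const).inter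
      (isOpen_lt (f := fun z : ℂ => ‖z / 2 + 1 / 2‖) (by fun_prop) continuous_const)
  have h3 : ‖(1 / 3 : ℝ)‖ < 1 := by norm_num
  have := Complex.differentiableOn_tsum_of_summable_norm (F := fun k s => seriesTerm s k)
    (summable_choose_mul_geometric_of_norm_lt_one N h3) (fun k z hz => ?_) hopen
    (fun k z hz => norm_seriesTerm_le hz.1.le (hz.2.le.trans (by linarith)) k)
  · exact (this.differentiableAt (hopen.mem_nhds ⟨hs, hN⟩)).differentiableWithinAt
  · have hne : (ascPochhammer ℂ k).eval (3 / 2 - z) ≠ 0 := by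
      apply eval_ascPochhammer_ne_zero
      intro j h
      have h' := congrArg Complex.re h
      have e : (3 / 2 - z).re = 3 / 2 - z.re := by simp
      rw [e] at h'
      have hj : (0 : ℝ) ≤ j := j.cast_nonneg
      have := hz.1
      simp at h'
      linarith
    have hf : (Nat.factorial k : ℂ) ≠ 0 := by exact_mod_cast k.factorial_ne_zero
    unfold seriesTerm
    apply DifferentiableAt.differentiableWithinAt
    have d := differentiable_eval_ascPochhammer k
    have d1 : DifferentiableAt ℂ (fun z : ℂ => (ascPochhammer ℂ k).eval (z / 2)) z :=
      (d _).comp z (by fun_prop)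
    have d2 : DifferentiableAt ℂ (fun z : ℂ => (ascPochhammer ℂ k).eval (z / 2 + 1 / 2)) z :=
      (d _).comp z (by fun_prop)
    have d3 : DifferentiableAt ℂ (fun z : ℂ => (ascPochhammer ℂ k).eval (3 / 2 - z)) z :=
      (d _).comp z (by fun_prop)
    exact ((d1.mul d2).div (d3.mul_const _) (mul_ne_zero hne hf)).mul_const _

theorem eq_of_norm_le_sqrt {g : ℂ → ℂ} {C : ℝ} (hd : ∀ z ≠ 0, DifferentiableAt ℂ g z)
    (hzero : ∀ z ≠ 0, ‖z‖ ≤ 1 → ‖g z‖ ≤ C / √‖z‖) (htop : ∀ z, 1 ≤ ‖z‖ → ‖g z‖ ≤ C * √‖z‖)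
    {z w : ℂ} (hz : z ≠ 0) (hw : w ≠ 0) : g z = g w := by
  have hlim : (fun z => g z - g 0) =o[nhdsWithin 0 {0}ᶜ] fun z : ℂ => (z - 0)⁻¹ := by
    have hne : ∀ᶠ z : ℂ in nhdsWithin 0 {0}ᶜ, z ≠ 0 := eventually_mem_nhdsWithin
    rw [Asymptotics.isLittleO_iff_tendsto' (by
      filter_upwards [hne] with z hz h
      exact absurd h (by simpa using hz))]
    have hle : ∀ᶠ z : ℂ in nhdsWithin 0 {0}ᶜ, ‖z‖ ≤ 1 := by
      refine Filter.Eventually.filter_mono nhdsWithin_le_nhds ?_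
      filter_upwards [Metric.ball_mem_nhds (0 : ℂ) one_pos] with z hz
      simpa using (mem_ball_zero_iff.1 hz).le
    have ht : Filter.Tendsto (fun z : ℂ => C * √‖z‖ + ‖g 0‖ * ‖z‖) (nhdsWithin 0 {0}ᶜ) (nhds 0) := by
      refine Filter.Tendsto.mono_left ?_ nhdsWithin_le_nhds
      have : Continuous fun z : ℂ => C * √‖z‖ + ‖g 0‖ * ‖z‖ := by fun_prop
      simpa using this.tendsto 0
    refine squeeze_zero_norm' ?_ ht
    filter_upwards [hne, hle] with z hz hz1
    have hp : 0 < ‖z‖ := norm_pos_iff.2 hz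
    have hs : 0 < √‖z‖ := Real.sqrt_pos.2 hp
    rw [sub_zero, div_inv_eq_mul, norm_mul]
    calc ‖g z - g 0‖ * ‖z‖ ≤ (C / √‖z‖ + ‖g 0‖) * ‖z‖ := by
          gcongr
          exact (norm_sub_le _ _).trans (by gcongr; exact hzero z hz hz1)
      _ = C / √‖z‖ * (√‖z‖ * √‖z‖) + ‖g 0‖ * ‖z‖ := by
          rw [Real.mul_self_sqrt hp.le]; ring
      _ = _ := by field_simp
  have hG := Complex.differentiableOn_update_limUnder_of_isLittleO (s := Set.univ)
    Filter.univ_mem (fun z hz => (hd z (by simpa using hz)).differentiableWithinAt) hlim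
  set G := Function.update g 0 ((nhdsWithin 0 {0}ᶜ).limUnder g) with hGdef
  have hGg : ∀ z ≠ 0, G z = g z := fun z hz => Function.update_of_ne hz _ _
  have hD : Differentiable ℂ (dslope G 0) :=
    differentiableOn_univ.1 ((Complex.differentiableOn_dslope Filter.univ_mem).2 hG)
  have hnorm := tendsto_norm_cocompact_atTop (E := ℂ)
  have ht : Filter.Tendsto (dslope G 0) (Filter.cocompact ℂ) (nhds 0) := by
    have h1 : Filter.Tendsto (fun z : ℂ => C * (√‖z‖)⁻¹ + ‖G 0‖ * ‖z‖⁻¹) (Filter.cocompact ℂ)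
        (nhds (C * 0 + ‖G 0‖ * 0)) :=
      ((tendsto_inv_atTop_zero.comp (Real.tendsto_sqrt_atTop.comp hnorm)).const_mul C).add
        ((tendsto_inv_atTop_zero.comp hnorm).const_mul _)
    rw [mul_zero, mul_zero, add_zero] at h1
    refine squeeze_zero_norm' ?_ h1
    filter_upwards [hnorm.eventually_ge_atTop 1] with z hz1
    have hp : 0 < ‖z‖ := by linarith
    have hz : z ≠ 0 := norm_pos_iff.1 hp
    have hs : 0 < √‖z‖ := Real.sqrt_pos.2 hp
    rw [dslope_of_ne _ hz, slope_def_module, sub_zero, norm_smul, norm_inv, hGg z hz]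
    calc ‖z‖⁻¹ * ‖g z - G 0‖ ≤ ‖z‖⁻¹ * (C * √‖z‖ + ‖G 0‖) := by
          gcongr
          exact (norm_sub_le _ _).trans (by gcongr; exact htop z hz1)
      _ = C * ((√‖z‖ * √‖z‖)⁻¹ * √‖z‖) + ‖G 0‖ * ‖z‖⁻¹ := by
          rw [Real.mul_self_sqrt hp.le]; ring
      _ = _ := by field_simp
  have hconst : ∀ z ≠ 0, g z = G 0 := by
    intro z hz
    have h := hD.apply_eq_of_tendsto_cocompact z ht
    rw [dslope_of_ne _ hz, slope_def_module, sub_zero, smul_eq_zero, hGg z hz] at h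
    exact sub_eq_zero.1 (h.resolve_left (inv_ne_zero hz))
  rw [hconst z hz, hconst w hw]

theorem log_div_two_pi_I (q : ℂ) : Complex.log q / (2 * π * Complex.I) =
    ((q.arg / (2 * π) : ℝ) : ℂ) + ((-(Real.log ‖q‖ / (2 * π)) : ℝ) : ℂ) * Complex.I := by
  have hpi : (π : ℂ) ≠ 0 := by exact_mod_cast Real.pi_ne_zero
  rw [Complex.log]
  push_cast
  field_simp
  linear_combination (Real.log ‖q‖ : ℂ) * Complex.I_sq

theorem log_div_two_pi_I_re (q : ℂ) :
    (Complex.log q / (2 * π * Complex.I)).re = q.arg / (2 * π) := by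
  rw [log_div_two_pi_I, Complex.add_re, Complex.ofReal_re, Complex.re_ofReal_mul, Complex.I_re,
    mul_zero, add_zero]

theorem log_div_two_pi_I_im (q : ℂ) :
    (Complex.log q / (2 * π * Complex.I)).im = -(Real.log ‖q‖ / (2 * π)) := by
  rw [log_div_two_pi_I, Complex.add_im, Complex.ofReal_im, Complex.im_ofReal_mul, Complex.I_im,
    mul_one, zero_add]

theorem eq_of_periodic_of_growth {p : ℂ → ℂ} {C : ℝ}
    (hd : DifferentiableOn ℂ p {s | s.re < 1}) (hper : ∀ s : ℂ, s.re < 0 → p (s + 1) = p s)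
    (hb : ∀ s : ℂ, |s.re| ≤ 1 / 2 → ‖p s‖ ≤ C * Real.exp |s.im|) {s : ℂ} (hs : s.re < 1) :
    p s = p 0 := by
  have hpi := Real.pi_pos
  have hpiC : (π : ℂ) ≠ 0 := by exact_mod_cast Real.pi_ne_zero
  have hC : 0 ≤ C := by simpa using (norm_nonneg _).trans (hb 0 (by simp))
  have hopen : IsOpen {s : ℂ | s.re < 1} := isOpen_lt Complex.continuous_re continuous_const
  have hat : ∀ s : ℂ, s.re < 1 → DifferentiableAt ℂ p s := fun s hs =>
    hd.differentiableAt (hopen.mem_nhds hs)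
  set g : ℂ → ℂ := fun q => p (Complex.log q / (2 * π * Complex.I)) with hg
  have hgd : ∀ q ≠ 0, DifferentiableAt ℂ g q := by
    intro q hq
    by_cases hslit : q ∈ Complex.slitPlane
    · refine (hat _ ?_).comp q ((Complex.differentiableAt_log hslit).div_const _)
      rw [log_div_two_pi_I_re, div_lt_one (by positivity)]
      linarith [Complex.arg_le_pi q]
    · have hre : q.re < 0 := by
        rw [Complex.mem_slitPlane_iff] at hslit
        push Not at hslit
        refine lt_of_le_of_ne hslit.1 fun h => hq (Complex.ext h hslit.2)
      have hloc : g =ᶠ[nhds q] fun z => p (1 / 2 + Complex.log (-z) / (2 * π * Complex.I)) := by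
        filter_upwards [(isOpen_lt Complex.continuous_re continuous_const).mem_nhds hre] with z hz
        have hz' : z.re < 0 := hz
        rcases lt_or_ge z.im 0 with him | him
        · have hl : Complex.log (-z) = Complex.log z + π * Complex.I := by
            rw [Complex.log, Complex.log, norm_neg, Complex.arg_neg_eq_arg_add_pi_of_im_neg him]
            push_cast; ring
          have e : 1 / 2 + Complex.log (-z) / (2 * π * Complex.I) =
              Complex.log z / (2 * π * Complex.I) + 1 := by
            rw [hl, add_div]
            have : (π * Complex.I) / (2 * π * Complex.I) = (1 / 2 : ℂ) := by
              field_simp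
            rw [this]; ring
          rw [e, hper]
          rw [log_div_two_pi_I_re]
          exact div_neg_of_neg_of_pos (Complex.arg_neg_iff.2 him) (by positivity)
        · have ha : (-z).arg = z.arg - π := Complex.arg_neg_eq_arg_sub_pi_iff.2 (by
            rcases him.lt_or_eq with h | h
            · exact Or.inl h
            · exact Or.inr ⟨h.symm, hz'⟩)
          have hl : Complex.log (-z) = Complex.log z - π * Complex.I := by
            rw [Complex.log, Complex.log, norm_neg, ha]
            push_cast; ring
          have e : 1 / 2 + Complex.log (-z) / (2 * π * Complex.I) =
              Complex.log z / (2 * π * Complex.I) := by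
            rw [hl, sub_div]
            have : (π * Complex.I) / (2 * π * Complex.I) = (1 / 2 : ℂ) := by
              field_simp
            rw [this]; ring
          rw [e]
      refine DifferentiableAt.congr_of_eventuallyEq ?_ hloc
      have hslit' : -q ∈ Complex.slitPlane := Or.inl (by simpa using hre)
      refine (hat _ ?_).comp q (f := fun z : ℂ => 1 / 2 + Complex.log (-z) / (2 * π * Complex.I))
        ((((Complex.differentiableAt_log hslit').comp q
          differentiableAt_id.neg).div_const _).const_add _)
      have hlt : (-q).arg < π := lt_of_le_of_ne (Complex.arg_le_pi _)
        (Complex.mem_slitPlane_iff_arg.1 hslit').1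
      rw [Complex.add_re, log_div_two_pi_I_re]
      have : (-q).arg / (2 * π) < 1 / 2 := by
        rw [div_lt_iff₀ (by positivity)]; linarith
      norm_num
      linarith
  have hgb : ∀ q, ‖g q‖ ≤ C * Real.exp (|Real.log ‖q‖| / 2) := by
    intro q
    refine (hb _ ?_).trans ?_
    · rw [log_div_two_pi_I_re, abs_div, abs_of_pos (by positivity : 0 < 2 * π),
        div_le_iff₀ (by positivity)]
      linarith [Complex.abs_arg_le_pi q]
    · rw [log_div_two_pi_I_im, abs_neg, abs_div, abs_of_pos (by positivity : 0 < 2 * π)]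
      gcongr
      linarith [Real.pi_gt_three]
  have hexp : ∀ r : ℝ, 0 < r → Real.exp (Real.log r / 2) = √r := by
    intro r hr
    rw [Real.exp_half, Real.exp_log hr]
  have hgc : ∀ z ≠ 0, g z = g 1 := by
    intro z hz
    refine eq_of_norm_le_sqrt (C := C) hgd (fun q hq hq1 => (hgb q).trans_eq ?_)
      (fun q hq1 => (hgb q).trans_eq ?_) hz one_ne_zero
    · have hq0 : 0 < ‖q‖ := norm_pos_iff.2 hq
      rw [abs_of_nonpos (Real.log_nonpos hq0.le hq1), neg_div, Real.exp_neg, hexp _ hq0,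
        div_eq_mul_inv]
    · rw [abs_of_nonneg (Real.log_nonneg hq1), hexp _ (by linarith)]
  have hloc : p =ᶠ[nhds 0] fun _ => p 0 := by
    have hop : IsOpen {s : ℂ | |s.re| < 1 / 2} := isOpen_lt (by fun_prop) continuous_const
    filter_upwards [hop.mem_nhds (by simp : (0 : ℂ) ∈ {s : ℂ | |s.re| < 1 / 2})] with s hs
    have hs' := abs_lt.1 (show |s.re| < 1 / 2 from hs)
    have h := hgc (Complex.exp (2 * π * Complex.I * s)) (Complex.exp_ne_zero _)
    have him : (2 * π * Complex.I * s).im = 2 * π * s.re := by simp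
    simp only [hg] at h
    rw [Complex.log_exp (by rw [him]; nlinarith) (by rw [him]; nlinarith), Complex.log_one,
      zero_div, mul_div_cancel_left₀ _ (by simp [hpiC])] at h
    exact h
  exact (hd.analyticOnNhd hopen).eqOn_of_preconnected_of_eventuallyEq analyticOnNhd_const
    (convex_halfSpace_re_lt 1).isPreconnected (by simp) hloc hs

theorem exists_norm_Gamma_ratio_le : ∃ M : ℝ, ∀ s : ℂ, s.re ≤ 1 / 2 →
    ‖Complex.Gamma (4 / 3 - s) / Complex.Gamma (3 / 2 - s)‖ ≤ M := by
  have hint := (Complex.betaIntegral_convergent (u := 5 / 6) (v := 1 / 6)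
    (by norm_num) (by norm_num)).norm
  set f : ℝ → ℝ := fun x => ‖(x : ℂ) ^ (5 / 6 - 1 : ℂ) * (1 - (x : ℂ)) ^ (1 / 6 - 1 : ℂ)‖ with hf
  refine ⟨(∫ x in (0 : ℝ)..1, f x) / ‖Complex.Gamma (1 / 6)‖, fun s hs => ?_⟩
  have e1 : (4 / 3 - s).re = 4 / 3 - s.re := by simp
  have e2 : (3 / 2 - s).re = 3 / 2 - s.re := by simp
  have hG : Complex.Gamma (1 / 6) ≠ 0 := Complex.Gamma_ne_zero_of_re_pos (by norm_num)
  have hG' : Complex.Gamma (3 / 2 - s) ≠ 0 :=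
    Complex.Gamma_ne_zero_of_re_pos (by rw [e2]; linarith)
  have hbeta := Complex.Gamma_mul_Gamma_eq_betaIntegral (s := 4 / 3 - s) (t := 1 / 6)
    (by rw [e1]; linarith) (by norm_num)
  have e3 : 4 / 3 - s + 1 / 6 = 3 / 2 - s := by ring
  rw [e3] at hbeta
  have hratio : Complex.Gamma (4 / 3 - s) / Complex.Gamma (3 / 2 - s) =
      Complex.betaIntegral (4 / 3 - s) (1 / 6) / Complex.Gamma (1 / 6) := by
    rw [div_eq_div_iff hG' hG, hbeta, mul_comm]
  rw [hratio, norm_div]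
  gcongr
  refine intervalIntegral.norm_integral_le_of_norm_le zero_le_one
    (Filter.Eventually.of_forall fun x hx => ?_) hint
  simp only [hf]
  rw [norm_mul, norm_mul]
  gcongr ?_ * _
  rw [Complex.norm_cpow_eq_rpow_re_of_pos hx.1, Complex.norm_cpow_eq_rpow_re_of_pos hx.1]
  refine Real.rpow_le_rpow_of_exponent_ge hx.1 hx.2 ?_
  rw [Complex.sub_re, Complex.sub_re, e1]
  norm_num
  linarith

theorem norm_tsum_seriesTerm_le_exp {s : ℂ} (hs : |s.re| ≤ 1 / 2) :
    ‖∑' k, seriesTerm s k‖ ≤ Real.exp 3 * Real.exp |s.im| := by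
  have hre := abs_le.1 hs
  set N := ⌈‖s / 2 + 1 / 2‖⌉₊
  have hle : ‖s / 2 + 1 / 2‖ ≤ |s.im| / 2 + 3 / 4 := by
    calc ‖s / 2 + 1 / 2‖ ≤ ‖s / 2‖ + ‖(1 / 2 : ℂ)‖ := norm_add_le _ _
      _ = ‖s‖ / 2 + 1 / 2 := by norm_num
      _ ≤ (|s.re| + |s.im|) / 2 + 1 / 2 := by gcongr; exact Complex.norm_le_abs_re_add_abs_im s
      _ ≤ _ := by linarith
  have hN : (N : ℝ) < ‖s / 2 + 1 / 2‖ + 1 := Nat.ceil_lt_add_one (norm_nonneg _)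
  refine (norm_tsum_seriesTerm_le (N := N) (by linarith)
    ((Nat.le_ceil _).trans (by linarith))).trans ?_
  calc (3 / 2 : ℝ) ^ (N + 1) ≤ (Real.exp 1) ^ (N + 1) := by
        gcongr
        linarith [Real.add_one_le_exp (1 : ℝ)]
    _ = Real.exp (N + 1) := by rw [← Real.exp_nat_mul]; simp
    _ ≤ Real.exp (3 + |s.im|) := by
        rw [Real.exp_le_exp]
        linarith [abs_nonneg s.im]
    _ = _ := Real.exp_add _ _

theorem ne_neg_natCast_of_re_pos {z : ℂ} (hz : 0 < z.re) (k : ℕ) : z ≠ -(k : ℂ) := by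
  intro h
  have := congrArg Complex.re h
  simp only [Complex.neg_re, Complex.natCast_re] at this
  linarith [(k.cast_nonneg : (0 : ℝ) ≤ k)]

theorem tsum_seriesTerm_mul_eq {s : ℂ} (hs : s.re < 1) :
    (∑' k, seriesTerm s k) * (Complex.Gamma (4 / 3 - s) / Complex.Gamma (3 / 2 - s)) *
      (8 / 9 : ℂ) ^ s = Complex.Gamma (4 / 3) / Complex.Gamma (3 / 2) := by
  have h89 : (8 / 9 : ℂ) ≠ 0 := by norm_num
  set p : ℂ → ℂ := fun s => (∑' k, seriesTerm s k) *
    (Complex.Gamma (4 / 3 - s) / Complex.Gamma (3 / 2 - s)) * (8 / 9 : ℂ) ^ s with hp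
  have e1 (s : ℂ) : (4 / 3 - s).re = 4 / 3 - s.re := by simp
  have e2 (s : ℂ) : (3 / 2 - s).re = 3 / 2 - s.re := by simp
  have hd : DifferentiableOn ℂ p {s | s.re < 1} := by
    refine (differentiableOn_tsum_seriesTerm.mul fun z hz => ?_).mul fun z _ => ?_
    · have hz' : z.re < 1 := hz
      have h1 : 0 < (4 / 3 - z).re := by rw [e1]; linarith
      have h2 : 0 < (3 / 2 - z).re := by rw [e2]; linarith
      have d1 : DifferentiableAt ℂ (fun z : ℂ => Complex.Gamma (4 / 3 - z)) z :=
        (Complex.differentiableAt_Gamma _ (ne_neg_natCast_of_re_pos h1)).comp z (by fun_prop)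
      have d2 : DifferentiableAt ℂ (fun z : ℂ => Complex.Gamma (3 / 2 - z)) z :=
        (Complex.differentiableAt_Gamma _ (ne_neg_natCast_of_re_pos h2)).comp z (by fun_prop)
      exact (d1.div d2 (Complex.Gamma_ne_zero_of_re_pos h2)).differentiableWithinAt
    · exact (differentiableAt_id.const_cpow (Or.inl h89)).differentiableWithinAt
  have hper : ∀ s : ℂ, s.re < 0 → p (s + 1) = p s := by
    intro s hs
    have h1 : 0 < (1 / 3 - s).re := by
      rw [Complex.sub_re]; norm_num; linarith
    have h2 : 0 < (1 / 2 - s).re := by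
      rw [Complex.sub_re]; norm_num; linarith
    have h1' : 1 / 3 - s ≠ 0 := by simpa using ne_neg_natCast_of_re_pos h1 0
    have h2' : 1 / 2 - s ≠ 0 := by simpa using ne_neg_natCast_of_re_pos h2 0
    have hrec := tsum_seriesTerm_add_one (ne_neg_natCast_of_re_pos h2)
    have g1 := Complex.Gamma_add_one _ h1'
    have g2 := Complex.Gamma_add_one _ h2'
    have k1 : 1 / 3 - s + 1 = 4 / 3 - s := by ring
    have k2 : 1 / 2 - s + 1 = 3 / 2 - s := by ring
    have k3 : 4 / 3 - (s + 1) = 1 / 3 - s := by ring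
    have k4 : 3 / 2 - (s + 1) = 1 / 2 - s := by ring
    have hS : ∑' k, seriesTerm (s + 1) k =
        9 / 8 * (1 / 3 - s) * (∑' k, seriesTerm s k) / (1 / 2 - s) := by
      rw [eq_div_iff h2', mul_comm, hrec]
    have hG := Complex.Gamma_ne_zero_of_re_pos h2
    simp only [hp]
    rw [k3, k4, hS, ← k1, ← k2, g1, g2, Complex.cpow_add _ _ h89, Complex.cpow_one]
    generalize 1 / 2 - s = D at *
    field_simp
  obtain ⟨M, hM⟩ := exists_norm_Gamma_ratio_le
  have hM0 : 0 ≤ M := (norm_nonneg _).trans (hM 0 (by simp))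
  have hb : ∀ s : ℂ, |s.re| ≤ 1 / 2 →
      ‖p s‖ ≤ Real.exp 3 * M * (9 / 8) * Real.exp |s.im| := by
    intro s hs
    have hre := abs_le.1 hs
    have hpow : ‖(8 / 9 : ℂ) ^ s‖ ≤ 9 / 8 := by
      have e : (8 / 9 : ℂ) = ((8 / 9 : ℝ) : ℂ) := by norm_num
      rw [e, Complex.norm_cpow_eq_rpow_re_of_pos (by norm_num)]
      calc (8 / 9 : ℝ) ^ s.re ≤ (8 / 9 : ℝ) ^ (-1 : ℝ) :=
            Real.rpow_le_rpow_of_exponent_ge (by norm_num) (by norm_num) (by linarith)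
        _ = 9 / 8 := by rw [Real.rpow_neg_one]; norm_num
    simp only [hp, norm_mul]
    calc _ ≤ (Real.exp 3 * Real.exp |s.im|) * M * (9 / 8) := by
          gcongr
          · exact norm_tsum_seriesTerm_le_exp hs
          · exact hM s hre.2
      _ = _ := by ring
  have h := eq_of_periodic_of_growth hd hper hb hs
  simpa only [hp, tsum_seriesTerm_zero, sub_zero, Complex.cpow_zero, mul_one, one_mul] using h

theorem tsum_seriesTerm_eq (n : ℕ) {s : ℂ} (hn : s.re < n + 1)
    (h1 : ∀ k : ℕ, 3 / 2 - s ≠ -(k : ℂ)) (h2 : ∀ k : ℕ, 4 / 3 - s ≠ -(k : ℂ)) :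
    ∑' k, seriesTerm s k = (9 / 8 : ℂ) ^ s * Complex.Gamma (3 / 2 - s) * Complex.Gamma (4 / 3) /
      (Complex.Gamma (3 / 2) * Complex.Gamma (4 / 3 - s)) := by
  have h98 : (9 / 8 : ℂ) ≠ 0 := by norm_num
  have hG : Complex.Gamma (3 / 2) ≠ 0 := Complex.Gamma_ne_zero_of_re_pos (by norm_num)
  induction n generalizing s with
  | zero =>
    have h := tsum_seriesTerm_mul_eq (s := s) (by simpa using hn)
    have hg1 := Complex.Gamma_ne_zero h1
    have hg2 := Complex.Gamma_ne_zero h2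
    have hc : (8 / 9 : ℂ) ^ s * (9 / 8 : ℂ) ^ s = 1 := by
      have e1 : (8 / 9 : ℂ) = ((8 / 9 : ℝ) : ℂ) := by norm_num
      have e2 : (9 / 8 : ℂ) = ((9 / 8 : ℝ) : ℂ) := by norm_num
      rw [e1, e2, ← Complex.mul_cpow_ofReal_nonneg (by norm_num) (by norm_num), ← e1, ← e2]
      norm_num
    rw [eq_div_iff (mul_ne_zero hG hg2)]
    rw [eq_div_iff hG] at h
    have h' : (∑' k, seriesTerm s k) * Complex.Gamma (4 / 3 - s) * (8 / 9 : ℂ) ^ s *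
        Complex.Gamma (3 / 2) = Complex.Gamma (4 / 3) * Complex.Gamma (3 / 2 - s) := by
      rw [← h]
      generalize Complex.Gamma (3 / 2 - s) = G at *
      field_simp
    linear_combination (9 / 8 : ℂ) ^ s * h' - (∑' k, seriesTerm s k) * Complex.Gamma (4 / 3 - s) *
      Complex.Gamma (3 / 2) * hc
  | succ n ih =>
    obtain ⟨t, rfl⟩ : ∃ t, s = t + 1 := ⟨s - 1, by ring⟩
    have k3 : 4 / 3 - (t + 1) = 1 / 3 - t := by ring
    have k4 : 3 / 2 - (t + 1) = 1 / 2 - t := by ring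
    rw [k3] at h2 ⊢
    rw [k4] at h1 ⊢
    have k1 : 1 / 3 - t + 1 = 4 / 3 - t := by ring
    have k2 : 1 / 2 - t + 1 = 3 / 2 - t := by ring
    have h1' : 1 / 2 - t ≠ 0 := by simpa using h1 0
    have h2' : 1 / 3 - t ≠ 0 := by simpa using h2 0
    have hrec := tsum_seriesTerm_add_one h1
    have hprev := ih (s := t) (by push_cast [Complex.add_re, Complex.one_re] at hn; linarith)
      (fun k hk => h1 (k + 1) (by push_cast; linear_combination hk))
      (fun k hk => h2 (k + 1) (by push_cast; linear_combination hk))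
    rw [hprev, ← k1, ← k2, Complex.Gamma_add_one _ h1', Complex.Gamma_add_one _ h2'] at hrec
    have hg := Complex.Gamma_ne_zero h2
    refine mul_left_cancel₀ h1' ?_
    rw [hrec, Complex.cpow_add _ _ h98, Complex.cpow_one]
    generalize 1 / 3 - t = D at *
    field_simp

theorem gauss_2F1_special_value_a (a : ℝ)
    (h1 : ∀ k : ℕ, (3 / 2 : ℝ) - 2 * a ≠ -(k : ℝ))
    (h2 : ∀ k : ℕ, (4 / 3 : ℝ) - 2 * a ≠ -(k : ℝ)) :
    ∑' k : ℕ, (ascPochhammer ℝ k).eval a * (ascPochhammer ℝ k).eval (a + 1 / 2) /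
        ((ascPochhammer ℝ k).eval (3 / 2 - 2 * a) * (Nat.factorial k : ℝ)) *
        (-1 / 3 : ℝ) ^ k
      = (9 / 8 : ℝ) ^ (2 * a) * 2 * Real.Gamma (3 / 2 - 2 * a) * Real.Gamma (4 / 3) /
          (Real.sqrt π * Real.Gamma (4 / 3 - 2 * a)) := by
  obtain ⟨n, hn⟩ := exists_nat_gt (2 * a)
  have h := tsum_seriesTerm_eq n (s := ((2 * a : ℝ) : ℂ)) (by rw [Complex.ofReal_re]; linarith)
    (fun k hk => h1 k (Complex.ofReal_injective (by push_cast at hk ⊢; exact hk)))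
    (fun k hk => h2 k (Complex.ofReal_injective (by push_cast at hk ⊢; exact hk)))
  have hpoch (k : ℕ) (x : ℝ) :
      (((ascPochhammer ℝ k).eval x : ℝ) : ℂ) = (ascPochhammer ℂ k).eval (x : ℂ) := by
    rw [← ascPochhammer_map Complex.ofRealHom, Polynomial.eval_map]
    exact (Polynomial.eval₂_at_apply Complex.ofRealHom x).symm
  have hterm (k : ℕ) : seriesTerm ((2 * a : ℝ) : ℂ) k =
      (((ascPochhammer ℝ k).eval a * (ascPochhammer ℝ k).eval (a + 1 / 2) /
        ((ascPochhammer ℝ k).eval (3 / 2 - 2 * a) * (Nat.factorial k : ℝ)) *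
        (-1 / 3 : ℝ) ^ k : ℝ) : ℂ) := by
    simp only [Complex.ofReal_mul, Complex.ofReal_div, Complex.ofReal_pow, hpoch, seriesTerm]
    push_cast
    rw [mul_div_cancel_left₀ _ (two_ne_zero' ℂ)]
  have hG : Real.Gamma (3 / 2) = √π / 2 := by
    have := Real.Gamma_add_one (s := 1 / 2) (by norm_num)
    rw [Real.Gamma_one_half_eq] at this
    rw [show (3 / 2 : ℝ) = 1 / 2 + 1 by norm_num, this]
    ring
  have hsqrt : √π ≠ 0 := (Real.sqrt_pos.2 Real.pi_pos).ne'
  have c1 : (9 / 8 : ℂ) = ((9 / 8 : ℝ) : ℂ) := by norm_num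
  have c2 : (3 / 2 : ℂ) = ((3 / 2 : ℝ) : ℂ) := by norm_num
  have c3 : (4 / 3 : ℂ) = ((4 / 3 : ℝ) : ℂ) := by norm_num
  simp only [hterm] at h
  rw [c1, c2, c3, ← Complex.ofReal_cpow (by norm_num), ← Complex.ofReal_sub, ← Complex.ofReal_sub,
    Complex.Gamma_ofReal, Complex.Gamma_ofReal, Complex.Gamma_ofReal, Complex.Gamma_ofReal,
    ← Complex.ofReal_tsum] at h
  have hreal := Complex.ofReal_injective (h.trans (by push_cast; rfl :
    _ = (((9 / 8 : ℝ) ^ (2 * a) * Real.Gamma (3 / 2 - 2 * a) * Real.Gamma (4 / 3) /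
      (Real.Gamma (3 / 2) * Real.Gamma (4 / 3 - 2 * a)) : ℝ) : ℂ)))
  rw [hreal, hG]
  have hg := Real.Gamma_ne_zero h2
  field_simp
end

section
/- Let a be a real number with a ≠ 1/2 such that 5/2 − 2a is not a nonpositive integer and neither 5/3 − 2a, 4/3 − 2a, nor 4 − 6a is a nonpositive integer. Then ₂F₁(a, a+1/2; 5/2−2a | −1/3) = (6^{−2a}/(1−2a)) · { 2·Γ(5/3−2a)/Γ(5/3) − Γ(4/3−2a)/Γ(4/3) } · Γ(4−4a)/Γ(4−6a). -/
open Polynomial Real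

/-- The general term of `₂F₁(a, a + 1/2; 5/2 - 2a | -1/3)`. -/
noncomputable def hypTerm (a : ℝ) (k : ℕ) : ℝ :=
  (ascPochhammer ℝ k).eval a * (ascPochhammer ℝ k).eval (a + 1 / 2) /
    ((ascPochhammer ℝ k).eval (5 / 2 - 2 * a) * (Nat.factorial k : ℝ)) * (-1 / 3 : ℝ) ^ k

/-- The closed form of `₂F₁(a, a + 1/2; 5/2 - 2a | -1/3)`. -/
noncomputable def hypValue (a : ℝ) : ℝ :=
  (6 : ℝ) ^ (-(2 * a)) / (1 - 2 * a) *
    (2 * Real.Gamma (5 / 3 - 2 * a) / Real.Gamma (5 / 3) -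
      Real.Gamma (4 / 3 - 2 * a) / Real.Gamma (4 / 3)) *
    (Real.Gamma (4 - 4 * a) / Real.Gamma (4 - 6 * a))

lemma hypTerm_zero (a : ℝ) : hypTerm a 0 = 1 := by simp [hypTerm]

lemma ascPochhammer_eval_ne_zero_of_ne_neg_nat {x : ℝ} (hx : ∀ k : ℕ, x ≠ -(k : ℝ)) (n : ℕ) :
    (ascPochhammer ℝ n).eval x ≠ 0 := by
  rw [Ne, ascPochhammer_eval_eq_zero_iff]
  rintro ⟨k, -, hk⟩
  exact hx k (by linarith)

lemma hypTerm_succ (a : ℝ) (ha : ∀ k : ℕ, (5 / 2 : ℝ) - 2 * a ≠ -(k : ℝ)) (k : ℕ) :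
    hypTerm a (k + 1) =
      (a + k) * (a + 1 / 2 + k) / ((5 / 2 - 2 * a + k) * (k + 1)) * (-1 / 3) * hypTerm a k := by
  have h0 := ascPochhammer_eval_ne_zero_of_ne_neg_nat ha k
  have h1 : 5 / 2 - 2 * a + k ≠ 0 := fun h => ha k (by linarith)
  have h2 : (k.factorial : ℝ) ≠ 0 := by positivity
  have h3 : (k + 1 : ℝ) ≠ 0 := by positivity
  simp only [hypTerm, ascPochhammer_succ_eval, Nat.factorial_succ, pow_succ]
  push_cast
  field_simp

lemma mul_ascPochhammer_eval_add_one (x : ℝ) (n : ℕ) :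
    x * (ascPochhammer ℝ n).eval (x + 1) = (x + n) * (ascPochhammer ℝ n).eval x := by
  induction n with
  | zero => simp
  | succ n ih =>
    rw [ascPochhammer_succ_eval, ascPochhammer_succ_eval, ← mul_assoc, ih]
    push_cast
    ring

lemma hypTerm_add_half (a : ℝ) (h0 : a ≠ 0)
    (ha : ∀ k : ℕ, (3 / 2 : ℝ) - 2 * a ≠ -(k : ℝ)) (k : ℕ) :
    hypTerm (a + 1 / 2) k =
      (a + k) * (3 / 2 - 2 * a + k) / (a * (3 / 2 - 2 * a)) * hypTerm a k := by
  have e1 := mul_ascPochhammer_eval_add_one a k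
  have e2 := mul_ascPochhammer_eval_add_one (3 / 2 - 2 * a) k
  have h1 := ascPochhammer_eval_ne_zero_of_ne_neg_nat ha k
  have h2 : (3 / 2 : ℝ) - 2 * a ≠ 0 := by simpa using ha 0
  have h3 : (3 / 2 : ℝ) - 2 * a + k ≠ 0 := fun h => ha k (by linarith)
  rw [show (3 / 2 : ℝ) - 2 * a + 1 = 5 / 2 - 2 * a by ring, mul_comm, ← eq_div_iff h2] at e2
  rw [mul_comm, ← eq_div_iff h0] at e1
  have h4 : (k.factorial : ℝ) ≠ 0 := by positivity
  simp only [hypTerm]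
  rw [show a + 1 / 2 + 1 / 2 = a + 1 by ring, show 5 / 2 - 2 * (a + 1 / 2) = 3 / 2 - 2 * a by ring,
    e1, e2]
  generalize 3 / 2 - 2 * a = c at *
  generalize a + 1 / 2 = d at *
  field_simp

lemma tendsto_nat_add_div_nat_add (x y : ℝ) :
    Filter.Tendsto (fun k : ℕ => ((k : ℝ) + x) / (k + y)) Filter.atTop (nhds 1) := by
  simpa [add_comm] using tendsto_add_mul_div_add_mul_atTop_nhds x y (1 : ℝ) one_ne_zero

lemma summable_pow_mul_hypTerm (a : ℝ) (ha : ∀ k : ℕ, (5 / 2 : ℝ) - 2 * a ≠ -(k : ℝ)) (n : ℕ) :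
    Summable fun k : ℕ => (k : ℝ) ^ n * hypTerm a k := by
  have hlim : Filter.Tendsto (fun k : ℕ => (((k : ℝ) + 1) / (k + 0)) ^ n *
      (((k : ℝ) + a) / (k + (5 / 2 - 2 * a)) * (((k : ℝ) + (a + 1 / 2)) / (k + 1)) * (-1 / 3)))
      Filter.atTop (nhds (1 ^ n * (1 * 1 * (-1 / 3)))) :=
    ((tendsto_nat_add_div_nat_add 1 0).pow n).mul
      (((tendsto_nat_add_div_nat_add _ _).mul (tendsto_nat_add_div_nat_add _ _)).mul_const _)
  have hlt : ‖(1 : ℝ) ^ n * (1 * 1 * (-1 / 3))‖ < 1 / 2 := by norm_num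
  refine summable_of_ratio_norm_eventually_le (r := 1 / 2) (by norm_num) ?_
  filter_upwards [hlim.norm.eventually_lt_const hlt, Filter.eventually_gt_atTop 0] with k hk hk0
  have hk1 : (k : ℝ) ≠ 0 := by positivity
  have h1 : (k : ℝ) + (5 / 2 - 2 * a) ≠ 0 := fun h => ha k (by linarith)
  have h2 : 5 / 2 - 2 * a + k ≠ 0 := by rwa [add_comm]
  have : ((k + 1 : ℕ) : ℝ) ^ n * hypTerm a (k + 1) = ((((k : ℝ) + 1) / (k + 0)) ^ n *
      (((k : ℝ) + a) / (k + (5 / 2 - 2 * a)) * (((k : ℝ) + (a + 1 / 2)) / (k + 1)) * (-1 / 3))) *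
      ((k : ℝ) ^ n * hypTerm a k) := by
    rw [hypTerm_succ a ha]
    push_cast
    rw [add_zero, div_pow, add_comm (k : ℝ) (5 / 2 - 2 * a)]
    field_simp
    ring
  rw [this, norm_mul]
  gcongr

lemma summable_hypTerm (a : ℝ) (ha : ∀ k : ℕ, (5 / 2 : ℝ) - 2 * a ≠ -(k : ℝ)) :
    Summable (hypTerm a) := by
  simpa using summable_pow_mul_hypTerm a ha 0

/-- The three-term contiguous relation, obtained by creative telescoping. -/
lemma tsum_hypTerm_contiguous (a : ℝ) (h0 : a ≠ 0) (h0' : a ≠ -1 / 2)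
    (ha : ∀ k : ℕ, (1 / 2 : ℝ) - 2 * a ≠ -(k : ℝ)) :
    16 * (4 * a - 1) * (4 * a - 3) * (2 * a + 1) * ∑' k, hypTerm (a + 1) k
      - 288 * a ^ 2 * (4 * a - 3) * ∑' k, hypTerm (a + 1 / 2) k
      + 9 * (2 * a - 1) * (6 * a - 1) * (6 * a - 2) * ∑' k, hypTerm a k = 0 := by
  have ha1 : ∀ k : ℕ, (3 / 2 : ℝ) - 2 * a ≠ -(k : ℝ) := fun k h =>
    ha (k + 1) (by push_cast; linarith)
  have ha2 : ∀ k : ℕ, (5 / 2 : ℝ) - 2 * a ≠ -(k : ℝ) := fun k h =>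
    ha1 (k + 1) (by push_cast; linarith)
  have s0 := summable_hypTerm a ha2
  have s1 := summable_hypTerm (a + 1 / 2) fun k h => ha1 k (by linarith)
  have s2 := summable_hypTerm (a + 1) fun k h => ha k (by linarith)
  have hsum := ((s2.hasSum.mul_left (16 * (4 * a - 1) * (4 * a - 3) * (2 * a + 1))).sub
    (s1.hasSum.mul_left (288 * a ^ 2 * (4 * a - 3)))).add
    (s0.hasSum.mul_left (9 * (2 * a - 1) * (6 * a - 1) * (6 * a - 2)))
  refine tendsto_nhds_unique hsum.tendsto_sum_nat ?_
  have htele : ∀ n : ℕ, ∑ k ∈ Finset.range n,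
      (16 * (4 * a - 1) * (4 * a - 3) * (2 * a + 1) * hypTerm (a + 1) k
      - 288 * a ^ 2 * (4 * a - 3) * hypTerm (a + 1 / 2) k
      + 9 * (2 * a - 1) * (6 * a - 1) * (6 * a - 2) * hypTerm a k) =
      64 * (n * (3 / 2 - 2 * a + n) *
        (-3 / 16 * (2 * a - 1) * (2 * a - 2) + 3 / 2 * (2 * a - 3 / 2) * n - 3 * n ^ 2)) /
        (2 * a) * hypTerm a n := by
    intro n
    induction n with
    | zero => simp
    | succ n ih =>
      have e1 := hypTerm_add_half a h0 ha1 n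
      have e2 := hypTerm_add_half (a + 1 / 2) (fun h => h0' (by linarith))
        (fun k h => ha k (by linarith)) n
      rw [show a + 1 / 2 + 1 / 2 = a + 1 by ring, e1,
        show (3 / 2 : ℝ) - 2 * (a + 1 / 2) = 1 / 2 - 2 * a by ring] at e2
      have n1 : 5 / 2 - 2 * a + n ≠ 0 := fun h => ha2 n (by linarith)
      have n2 : (3 / 2 : ℝ) - 2 * a ≠ 0 := by simpa using ha1 0
      have n3 : (1 / 2 : ℝ) - 2 * a ≠ 0 := by simpa using ha 0
      have n4 : a + 1 / 2 ≠ 0 := fun h => h0' (by linarith)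
      have n5 : (n + 1 : ℝ) ≠ 0 := by positivity
      rw [Finset.sum_range_succ, ih, hypTerm_succ a ha2, e1, e2]
      push_cast
      generalize hypTerm a n = t
      rw [show 4 * a - 1 = -2 * (1 / 2 - 2 * a) by ring,
        show 4 * a - 3 = -2 * (3 / 2 - 2 * a) by ring,
        show 2 * a + 1 = 2 * (a + 1 / 2) by ring,
        show 3 / 2 - 2 * a + ((n : ℝ) + 1) = 5 / 2 - 2 * a + n by ring]
      generalize hu : 5 / 2 - 2 * a + (n : ℝ) = u at *
      generalize hv : 1 / 2 - 2 * a = v at *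
      generalize hw : 3 / 2 - 2 * a = w at *
      generalize hx : a + 1 / 2 = x at *
      field_simp
      subst hu hv hw hx
      ring
  simp_rw [htele]
  have hz := fun j => (summable_pow_mul_hypTerm a ha2 j).tendsto_atTop_zero
  have := (((hz 1).const_mul (64 / (2 * a) * (3 / 2 - 2 * a) *
      (-3 / 16 * (2 * a - 1) * (2 * a - 2)))).add
    ((hz 2).const_mul (64 / (2 * a) * ((-3 / 16 * (2 * a - 1) * (2 * a - 2)) +
      (3 / 2 - 2 * a) * (3 / 2 * (2 * a - 3 / 2)))))).add
    (((hz 3).const_mul (64 / (2 * a) * (3 / 2 * (2 * a - 3 / 2) - 3 * (3 / 2 - 2 * a)))).add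
    ((hz 4).const_mul (64 / (2 * a) * (-3))))
  simp only [mul_zero, add_zero] at this
  refine this.congr fun n => ?_
  ring

lemma hypValue_contiguous (a : ℝ) (ha : a ≠ -1 / 2) (ha' : a ≠ 0) (ha'' : a ≠ 1 / 2)
    (h1 : ∀ k : ℕ, (1 / 2 : ℝ) - 2 * a ≠ -(k : ℝ))
    (h2 : ∀ k : ℕ, (-1 / 3 : ℝ) - 2 * a ≠ -(k : ℝ))
    (h3 : ∀ k : ℕ, (-2 / 3 : ℝ) - 2 * a ≠ -(k : ℝ))
    (h4 : ∀ k : ℕ, (-2 : ℝ) - 6 * a ≠ -(k : ℝ)) :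
    16 * (4 * a - 1) * (4 * a - 3) * (2 * a + 1) * hypValue (a + 1)
      - 288 * a ^ 2 * (4 * a - 3) * hypValue (a + 1 / 2)
      + 9 * (2 * a - 1) * (6 * a - 1) * (6 * a - 2) * hypValue a = 0 := by
  have shift : ∀ {x : ℝ} (y : ℝ), y ≠ 0 → x = y + 1 → Gamma x = y * Gamma y := by
    rintro x y hy rfl
    exact Gamma_add_one hy
  have a1 : -1 / 3 - 2 * a ≠ 0 := by simpa using h2 0
  have a2 : 2 / 3 - 2 * a ≠ 0 := fun h => h2 1 (by push_cast; linarith)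
  have b1 : -2 / 3 - 2 * a ≠ 0 := by simpa using h3 0
  have b2 : 1 / 3 - 2 * a ≠ 0 := fun h => h3 1 (by push_cast; linarith)
  have c0 : -4 * a ≠ 0 := fun h => ha' (by linarith)
  have c1 : 1 - 4 * a ≠ 0 := fun h => h1 0 (by push_cast; linarith)
  have c2 : 2 - 4 * a ≠ 0 := fun h => ha'' (by linarith)
  have c3 : 3 - 4 * a ≠ 0 := fun h => h1 1 (by push_cast; linarith)
  have d0 : -2 - 6 * a ≠ 0 := by simpa using h4 0
  have d1 : -1 - 6 * a ≠ 0 := fun h => h4 1 (by push_cast; linarith)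
  have d2 : -6 * a ≠ 0 := fun h => h4 2 (by push_cast; linarith)
  have d3 : 1 - 6 * a ≠ 0 := fun h => h4 3 (by push_cast; linarith)
  have d4 : 2 - 6 * a ≠ 0 := fun h => h4 4 (by push_cast; linarith)
  have d5 : 3 - 6 * a ≠ 0 := fun h => h4 5 (by push_cast; linarith)
  have gA1 : Gamma (5 / 3 - 2 * (a + 1 / 2)) = (-1 / 3 - 2 * a) * Gamma (-1 / 3 - 2 * a) :=
    shift _ a1 (by ring)
  have gA2 : Gamma (5 / 3 - 2 * a) = (2 / 3 - 2 * a) * Gamma (5 / 3 - 2 * (a + 1 / 2)) := by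
    rw [shift _ a2 (by ring)]; ring_nf
  have gB1 : Gamma (4 / 3 - 2 * (a + 1 / 2)) = (-2 / 3 - 2 * a) * Gamma (-2 / 3 - 2 * a) :=
    shift _ b1 (by ring)
  have gB2 : Gamma (4 / 3 - 2 * a) = (1 / 3 - 2 * a) * Gamma (4 / 3 - 2 * (a + 1 / 2)) := by
    rw [shift _ b2 (by ring)]; ring_nf
  have gC1 : Gamma (4 - 4 * (a + 1 / 2)) = (1 - 4 * a) * ((-4 * a) * Gamma (-4 * a)) := by
    rw [shift _ c1 (by ring), shift _ c0 (by ring)]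
  have gC2 : Gamma (4 - 4 * a) = (3 - 4 * a) * ((2 - 4 * a) * Gamma (4 - 4 * (a + 1 / 2))) := by
    rw [shift _ c3 (by ring), shift _ c2 (by ring)]; ring_nf
  have gD1 : Gamma (4 - 6 * (a + 1 / 2)) =
      (-6 * a) * ((-1 - 6 * a) * ((-2 - 6 * a) * Gamma (-2 - 6 * a))) := by
    rw [shift _ d2 (by ring), shift _ d1 (by ring), shift _ d0 (by ring)]
  have gD2 : Gamma (4 - 6 * a) =
      (3 - 6 * a) * ((2 - 6 * a) * ((1 - 6 * a) * Gamma (4 - 6 * (a + 1 / 2)))) := by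
    rw [shift _ d5 (by ring), shift _ d4 (by ring), shift _ d3 (by ring)]; ring_nf
  have hD : Gamma (-2 - 6 * a) ≠ 0 := Gamma_ne_zero h4
  have hG1 : Gamma (4 / 3) ≠ 0 := (Gamma_pos_of_pos (by norm_num)).ne'
  have hG2 : Gamma (5 / 3) ≠ 0 := (Gamma_pos_of_pos (by norm_num)).ne'
  have m1 : 1 - 2 * a ≠ 0 := fun h => ha'' (by linarith)
  have m3 : -1 - 2 * a ≠ 0 := fun h => ha (by linarith)
  have p1 : (6 : ℝ) ^ (-(2 * (a + 1))) = 6 ^ (-(2 * a)) / 36 := by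
    rw [show -(2 * (a + 1)) = -(2 * a) - (2 : ℕ) by push_cast; ring, rpow_sub_natCast (by norm_num)]
    norm_num
  have p2 : (6 : ℝ) ^ (-(2 * (a + 1 / 2))) = 6 ^ (-(2 * a)) / 6 := by
    rw [show -(2 * (a + 1 / 2)) = -(2 * a) - 1 by ring, rpow_sub_one (by norm_num)]
  unfold hypValue
  rw [gA2, gB2, gC2, gD2, gA1, gB1, gC1, gD1, p1, p2,
    show 5 / 3 - 2 * (a + 1) = -1 / 3 - 2 * a by ring,
    show 4 / 3 - 2 * (a + 1) = -2 / 3 - 2 * a by ring,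
    show 4 - 4 * (a + 1) = -4 * a by ring, show 4 - 6 * (a + 1) = -2 - 6 * a by ring,
    show 1 - 2 * (a + 1) = -1 - 2 * a by ring, show 1 - 2 * (a + 1 / 2) = -2 * a by ring,
    show 3 - 6 * a = 3 * (1 - 2 * a) by ring]
  generalize (6 : ℝ) ^ (-(2 * a)) = P
  generalize Gamma (-1 / 3 - 2 * a) = A
  generalize Gamma (-2 / 3 - 2 * a) = B
  generalize Gamma (-4 * a) = C
  generalize Gamma (-2 - 6 * a) = D at *
  generalize Gamma (4 / 3) = E at *
  generalize Gamma (5 / 3) = F at *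
  have k1 : 2 * a + 1 ≠ 0 := fun h => ha (by linarith)
  have k2 : 3 * a + 1 ≠ 0 := fun h => d0 (by linarith)
  have k3 : 6 * a + 1 ≠ 0 := fun h => d1 (by linarith)
  have k4 : 1 - 3 * a ≠ 0 := fun h => d4 (by linarith)
  rw [show -1 - 2 * a = -(2 * a + 1) by ring, show -2 - 6 * a = -(2 * (3 * a + 1)) by ring,
    show -1 - 6 * a = -(6 * a + 1) by ring, show 2 - 6 * a = 2 * (1 - 3 * a) by ring]
  generalize hx1 : 2 * a + 1 = x1 at *
  generalize hx2 : 3 * a + 1 = x2 at *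
  generalize hx3 : 6 * a + 1 = x3 at *
  generalize hx4 : 1 - 3 * a = x4 at *
  generalize hx5 : 1 - 6 * a = x5 at *
  generalize hx6 : 1 - 2 * a = x6 at *
  field_simp
  subst hx1 hx2 hx3 hx4 hx5 hx6
  ring

/-- The Gauss multiplication formula for three factors, at positive arguments. -/
lemma Gamma_third_mul_Gamma_third_add {s : ℝ} (hs : 0 < s) :
    Gamma (s / 3) * Gamma (s / 3 + 1 / 3) * Gamma (s / 3 + 2 / 3) * 3 ^ s =
      3 * Gamma (1 / 3) * Gamma (2 / 3) * Gamma s := by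
  have hc : 0 < 3 * Gamma (1 / 3) * Gamma (2 / 3) := by
    have h1 := Gamma_pos_of_pos (show (0 : ℝ) < 1 / 3 by norm_num)
    have h2 := Gamma_pos_of_pos (show (0 : ℝ) < 2 / 3 by norm_num)
    positivity
  set c := 3 * Gamma (1 / 3) * Gamma (2 / 3) with hcdef
  let f : ℝ → ℝ := fun s =>
    Gamma (s / 3) * Gamma (s / 3 + 1 / 3) * Gamma (s / 3 + 2 / 3) * 3 ^ s / c
  have hpos : ∀ {t : ℝ} (j : ℝ), 0 ≤ j → 0 < t → 0 < Gamma (t / 3 + j) :=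
    fun j hj ht => Gamma_pos_of_pos (by positivity)
  have hconv : ∀ j : ℝ, 0 ≤ j → ConvexOn ℝ (Set.Ioi 0) fun t : ℝ => log (Gamma (t / 3 + j)) := by
    intro j hj
    refine ⟨convex_Ioi 0, fun x hx y hy p q hp hq hpq => ?_⟩
    have hx' : (0 : ℝ) < x / 3 + j := by have : (0 : ℝ) < x := hx; positivity
    have hy' : (0 : ℝ) < y / 3 + j := by have : (0 : ℝ) < y := hy; positivity
    have := convexOn_log_Gamma.2 hx' hy' hp hq hpq
    rwa [show p • (x / 3 + j) + q • (y / 3 + j) = (p • x + q • y) / 3 + j by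
      simp only [smul_eq_mul]; linear_combination j * hpq] at this
  have hlin : ConvexOn ℝ (Set.Ioi 0) fun t : ℝ => t * log 3 := by
    simpa only [mul_comm _ (log _)] using!
      (convexOn_id (convex_Ioi (0 : ℝ))).smul (log_pos (by norm_num : (1 : ℝ) < 3)).le
  have hf : Set.EqOn f Gamma (Set.Ioi 0) := by
    refine eq_Gamma_of_log_convex ?_ (fun {y} hy => ?_) (fun {y} hy => ?_) ?_
    · refine (((((hconv 0 le_rfl).add (hconv (1 / 3) (by norm_num))).add
        (hconv (2 / 3) (by norm_num))).add hlin).add_const (-log c)).congr fun t ht => ?_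
      have h0 := (hpos 0 le_rfl ht).ne'
      have h1 := (hpos (1 / 3) (by norm_num) ht).ne'
      have h2 := (hpos (2 / 3) (by norm_num) ht).ne'
      have h3 : (3 : ℝ) ^ t ≠ 0 := (rpow_pos_of_pos (by norm_num) _).ne'
      simp only [Pi.add_apply, Function.comp_apply, f]
      rw [add_zero] at h0 ⊢
      rw [log_div (by positivity) hc.ne', log_mul (by positivity) h3, log_mul (by positivity) h2,
        log_mul h0 h1, log_rpow (by norm_num)]
      ring
    · simp only [f]
      rw [show (y + 1) / 3 + 2 / 3 = y / 3 + 1 by ring,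
        show (y + 1) / 3 + 1 / 3 = y / 3 + 2 / 3 by ring,
        show (y + 1) / 3 = y / 3 + 1 / 3 by ring, Gamma_add_one (by positivity),
        rpow_add (by norm_num), rpow_one]
      ring
    · have h0 := hpos 0 le_rfl hy
      have h1 := hpos (1 / 3) (by norm_num) hy
      have h2 := hpos (2 / 3) (by norm_num) hy
      rw [add_zero] at h0
      have h3 : (0 : ℝ) < 3 ^ y := rpow_pos_of_pos (by norm_num) _
      simp only [f]
      positivity
    · simp only [f]
      rw [div_eq_one_iff_eq hc.ne', hcdef]
      norm_num
      ring
  have := hf hs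
  simp only [f] at this
  rw [div_eq_iff hc.ne'] at this
  rw [this, mul_comm]

lemma integral_rpow_mul_one_sub_rpow {u v p : ℝ} (hu : 0 < u) (hv : 0 < v) (hp : 0 < p) :
    ∫ x in (0 : ℝ)..1, x ^ (p * u - 1) * (1 - x ^ p) ^ (v - 1) =
      1 / p * (Gamma u * Gamma v / Gamma (u + v)) := by
  have hbeta : ∫ x in (0 : ℝ)..1, x ^ (u - 1) * (1 - x) ^ (v - 1) =
      Gamma u * Gamma v / Gamma (u + v) := by
    have h1 := Complex.betaIntegral_eq_Gamma_mul_div u v (by simpa) (by simpa)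
    rw [← Complex.ofReal_inj]
    push_cast [← Complex.Gamma_ofReal]
    rw [← h1, Complex.betaIntegral, ← intervalIntegral.integral_ofReal]
    refine intervalIntegral.integral_congr fun x hx => ?_
    rw [Set.uIcc_of_le zero_le_one] at hx
    push_cast [Complex.ofReal_cpow hx.1, Complex.ofReal_cpow (sub_nonneg.2 hx.2)]
    rfl
  rw [← hbeta]
  have hsub := MeasureTheory.integral_comp_rpow_Ioi_of_pos
    (g := Set.indicator (Set.Iic 1) fun x : ℝ => x ^ (u - 1) * (1 - x) ^ (v - 1)) hp
  rw [MeasureTheory.setIntegral_indicator measurableSet_Iic, Set.Ioi_inter_Iic] at hsub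
  rw [intervalIntegral.integral_of_le zero_le_one, intervalIntegral.integral_of_le zero_le_one,
    ← hsub, ← MeasureTheory.integral_const_mul, ← Set.Ioi_inter_Iic,
    ← MeasureTheory.setIntegral_indicator measurableSet_Iic]
  refine MeasureTheory.setIntegral_congr_fun measurableSet_Ioi fun x hx => ?_
  have hx : 0 < x := hx
  have hiff : x ^ p ≤ 1 ↔ x ≤ 1 := by
    rw [← one_rpow p, rpow_le_rpow_iff hx.le zero_le_one hp, one_rpow]
  by_cases h : x ≤ 1
  · simp only [Set.indicator, Set.mem_Iic, h, hiff, if_true, smul_eq_mul]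
    rw [← rpow_mul hx.le, show p * u - 1 = (p - 1) + p * (u - 1) by ring, rpow_add hx]
    field_simp
  · simp [Set.indicator, h, hiff]

/-- The increments of a primitive along a segment of the closed unit disc, as radial limits. -/
lemma tendsto_primitive_sub_segment {g G : ℂ → ℂ} (hg : ContinuousOn g (Metric.closedBall 0 1))
    (hG : ∀ z ∈ Metric.ball (0 : ℂ) 1, HasDerivAt G (g z) z) {α β : ℂ} {c d : ℝ} (hcd : c ≤ d)
    (hseg : ∀ t ∈ Set.Icc c d, ‖α + β * t‖ ≤ 1) :
    Filter.Tendsto (fun r : ℝ => G (r * (α + β * d)) - G (r * (α + β * c)))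
      (nhdsWithin 1 (Set.Ioo 0 1)) (nhds (β * ∫ t in c..d, g (α + β * t))) := by
  have hmem : ∀ r ∈ Set.Ioo (0 : ℝ) 1, ∀ t ∈ Set.Icc c d,
      (r * (α + β * t) : ℂ) ∈ Metric.ball (0 : ℂ) 1 := by
    intro r hr t ht
    rw [mem_ball_zero_iff, norm_mul, Complex.norm_real, norm_of_nonneg hr.1.le]
    nlinarith [hseg t ht, hr.1, hr.2, norm_nonneg (α + β * t)]
  have hcont : ∀ r ∈ Set.Ioo (0 : ℝ) 1,
      ContinuousOn (fun t : ℝ => g (r * (α + β * t))) (Set.Icc c d) := fun r hr =>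
    hg.comp (by fun_prop) fun t ht => Metric.ball_subset_closedBall (hmem r hr t ht)
  have hev : ∀ᶠ r : ℝ in nhdsWithin 1 (Set.Ioo 0 1), r ∈ Set.Ioo (0 : ℝ) 1 :=
    self_mem_nhdsWithin
  have hftc : ∀ r ∈ Set.Ioo (0 : ℝ) 1, r * β * ∫ t in c..d, g (r * (α + β * t)) =
      G (r * (α + β * d)) - G (r * (α + β * c)) := by
    intro r hr
    rw [← intervalIntegral.integral_const_mul]
    refine intervalIntegral.integral_eq_sub_of_hasDerivAt
      (f := fun t : ℝ => G (r * (α + β * t))) (fun t ht => ?_) ?_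
    · rw [Set.uIcc_of_le hcd] at ht
      have hlin : HasDerivAt (fun t : ℝ => (r * (α + β * t) : ℂ)) (r * β) t := by
        simpa using (((Complex.ofRealCLM.hasDerivAt (x := t)).const_mul β).const_add α).const_mul
          (r : ℂ)
      simpa [mul_comm] using! (hG _ (hmem r hr t ht)).comp t hlin
    · refine ContinuousOn.intervalIntegrable ?_
      rw [Set.uIcc_of_le hcd]
      exact continuousOn_const.mul (hcont r hr)
  obtain ⟨C, hC⟩ := (isCompact_closedBall (0 : ℂ) 1).exists_bound_of_continuousOn hg
  have hlim : Filter.Tendsto (fun r : ℝ => ∫ t in c..d, g (r * (α + β * t)))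
      (nhdsWithin 1 (Set.Ioo 0 1)) (nhds (∫ t in c..d, g (α + β * t))) := by
    refine intervalIntegral.tendsto_integral_filter_of_dominated_convergence (fun _ => C) ?_ ?_
      intervalIntegrable_const ?_
    · filter_upwards [hev] with r hr
      rw [Set.uIoc_of_le hcd]
      exact ((hcont r hr).mono Set.Ioc_subset_Icc_self).aestronglyMeasurable measurableSet_Ioc
    · filter_upwards [hev] with r hr
      refine Filter.Eventually.of_forall fun t ht => ?_
      rw [Set.uIoc_of_le hcd] at ht
      exact hC _ (Metric.ball_subset_closedBall (hmem r hr t (Set.Ioc_subset_Icc_self ht)))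
    · refine Filter.Eventually.of_forall fun t ht => ?_
      rw [Set.uIoc_of_le hcd] at ht
      have ht := Set.Ioc_subset_Icc_self ht
      have h1 : α + β * t ∈ Metric.closedBall (0 : ℂ) 1 := by simpa using hseg t ht
      refine (hg _ h1).tendsto.comp (tendsto_nhdsWithin_iff.2 ⟨?_, ?_⟩)
      · have : Continuous fun r : ℝ => (r * (α + β * t) : ℂ) := by fun_prop
        simpa using (this.tendsto 1).mono_left nhdsWithin_le_nhds
      · filter_upwards [hev] with r hr
        exact Metric.ball_subset_closedBall (hmem r hr t ht)
  have hr : Filter.Tendsto (fun r : ℝ => (r * β : ℂ)) (nhdsWithin 1 (Set.Ioo 0 1)) (nhds β) := by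
    have : Continuous fun r : ℝ => (r * β : ℂ) := by fun_prop
    simpa using (this.tendsto 1).mono_left nhdsWithin_le_nhds
  refine (hr.mul hlim).congr' ?_
  filter_upwards [hev] with r hr using hftc r hr

/-- The Cauchy theorem for the triangle with one vertex at the origin and its opposite side
`{α + β t | t ∈ [c, d]}` in the closed unit disc. -/
lemma integral_segment_eq_sub_radial {g : ℂ → ℂ} (hg : ContinuousOn g (Metric.closedBall 0 1))
    (hd : DifferentiableOn ℂ g (Metric.ball 0 1)) {α β : ℂ} {c d : ℝ} (hcd : c ≤ d)
    (hseg : ∀ t ∈ Set.Icc c d, ‖α + β * t‖ ≤ 1) :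
    β * ∫ t in c..d, g (α + β * t) =
      (α + β * d) * (∫ s in (0 : ℝ)..1, g ((α + β * d) * s)) -
        (α + β * c) * ∫ s in (0 : ℝ)..1, g ((α + β * c) * s) := by
  obtain ⟨G, hG⟩ := hd.isExactOn_ball
  have hradial : ∀ p : ℂ, ‖p‖ ≤ 1 → Filter.Tendsto (fun r : ℝ => G (r * p) - G 0)
      (nhdsWithin 1 (Set.Ioo 0 1)) (nhds (p * ∫ s in (0 : ℝ)..1, g (p * s))) := by
    intro p hp
    have := tendsto_primitive_sub_segment hg hG (α := 0) (β := p) zero_le_one (fun t ht => by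
      rw [zero_add, norm_mul, Complex.norm_real, norm_of_nonneg ht.1]
      exact mul_le_one₀ hp ht.1 ht.2)
    simpa using this
  have h1 := (hradial _ (hseg d ⟨hcd, le_rfl⟩)).sub (hradial _ (hseg c ⟨le_rfl, hcd⟩))
  have h2 := tendsto_primitive_sub_segment hg hG hcd hseg
  simp only [sub_sub_sub_cancel_right] at h1
  have : (nhdsWithin (1 : ℝ) (Set.Ioo 0 1)).NeBot := right_nhdsWithin_Ioo_neBot one_pos
  exact tendsto_nhds_unique h2 h1

lemma ofReal_mul_cpow_of_nonneg {r : ℝ} (hr : 0 ≤ r) (w : ℂ) {m : ℝ} (hm : 0 < m) :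
    (r * w : ℂ) ^ (m : ℂ) = ((r ^ m : ℝ) : ℂ) * w ^ (m : ℂ) := by
  have hm' : (m : ℂ) ≠ 0 := by exact_mod_cast hm.ne'
  rcases hr.eq_or_lt with rfl | hr
  · simp [Complex.zero_cpow hm', zero_rpow hm.ne']
  rcases eq_or_ne w 0 with rfl | hw
  · simp [Complex.zero_cpow hm']
  · have hr' : (r : ℂ) ≠ 0 := by exact_mod_cast hr.ne'
    rw [Complex.ofReal_cpow hr.le, Complex.cpow_def_of_ne_zero (mul_ne_zero hr' hw),
      Complex.cpow_def_of_ne_zero hr', Complex.cpow_def_of_ne_zero hw,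
      Complex.log_ofReal_mul hr hw, Complex.ofReal_log hr.le, ← Complex.exp_add, add_mul]

lemma integral_one_sub_sq_rpow_mul_cpow {m : ℝ} (hm : 0 < m) :
    ∫ x in (-1 : ℝ)..1, (((1 - x ^ 2) ^ (m + 1) : ℝ) : ℂ) *
        (1 - Complex.I / (√3 : ℝ) * x) ^ (m : ℂ) =
      (((8 / 9) ^ m * (8 / 3) * ∫ s in (0 : ℝ)..1, (1 - s) * (1 - s ^ 3) ^ m : ℝ) : ℂ) := by
  set q : ℂ := ((√3 : ℝ) : ℂ) with hq
  have hq2 : q ^ 2 = 3 := by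
    rw [hq, ← Complex.ofReal_pow, Real.sq_sqrt (by norm_num)]; norm_num
  have hq0 : q ≠ 0 := by intro h; rw [h] at hq2; norm_num at hq2
  have hq3 : q ^ 3 = 3 * q := by rw [pow_succ, hq2]
  have hI3 : Complex.I ^ 3 = -Complex.I := by rw [pow_succ, Complex.I_sq]; ring
  let g : ℂ → ℂ := fun u => 4 / 3 * (1 + Complex.I * u - u ^ 2) * (1 + Complex.I * u ^ 3) ^ (m : ℂ)
  have hre : ∀ u : ℂ, -‖u‖ ^ 3 ≤ (Complex.I * u ^ 3).re := by
    intro u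
    have := Complex.abs_re_le_norm (Complex.I * u ^ 3)
    rw [norm_mul, Complex.norm_I, one_mul, norm_pow] at this
    exact (abs_le.1 this).1
  have hgc : ContinuousOn g (Metric.closedBall 0 1) := by
    intro u hu
    have hu : ‖u‖ ≤ 1 := by simpa using hu
    have h0 : 0 ≤ (1 + Complex.I * u ^ 3).re := by
      have h1 := hre u
      have h2 : ‖u‖ ^ 3 ≤ 1 := pow_le_one₀ (norm_nonneg _) hu
      rw [Complex.add_re, Complex.one_re]
      linarith
    have hc := Complex.continuousAt_cpow_const_of_re_pos (w := (m : ℂ)) (Or.inl h0) (by simpa)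
    have hin : ContinuousAt (fun u : ℂ => 1 + Complex.I * u ^ 3) u := by fun_prop
    have hcomp : ContinuousAt (fun u : ℂ => (1 + Complex.I * u ^ 3) ^ (m : ℂ)) u :=
      ContinuousAt.comp (f := fun u : ℂ => 1 + Complex.I * u ^ 3) hc hin
    have hpoly : ContinuousAt (fun u : ℂ => 4 / 3 * (1 + Complex.I * u - u ^ 2)) u := by fun_prop
    exact (hpoly.mul hcomp).continuousWithinAt
  have hgd : DifferentiableOn ℂ g (Metric.ball 0 1) := by
    intro u hu
    have hu : ‖u‖ < 1 := by simpa using hu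
    have h0 : 1 + Complex.I * u ^ 3 ∈ Complex.slitPlane := by
      refine Or.inl ?_
      have h1 := hre u
      have h2 : ‖u‖ ^ 3 < 1 := pow_lt_one₀ (norm_nonneg _) hu (by norm_num)
      rw [Complex.add_re, Complex.one_re]
      linarith
    have hin : DifferentiableAt ℂ (fun u : ℂ => 1 + Complex.I * u ^ 3) u := by fun_prop
    have hpoly : DifferentiableAt ℂ (fun u : ℂ => 4 / 3 * (1 + Complex.I * u - u ^ 2)) u := by
      fun_prop
    exact (hpoly.mul (hin.cpow_const h0)).differentiableWithinAt
  have hseg : ∀ t ∈ Set.Icc (-1 : ℝ) 1, ‖Complex.I / 2 + q / 2 * t‖ ≤ 1 := by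
    intro t ht
    rw [Complex.norm_def, Real.sqrt_le_iff]
    refine ⟨zero_le_one, ?_⟩
    have : Complex.normSq (Complex.I / 2 + q / 2 * t) = 1 / 4 + 3 / 4 * t ^ 2 := by
      rw [show Complex.I / 2 + q / 2 * t = ((√3 / 2 * t : ℝ) : ℂ) + ((1 / 2 : ℝ) : ℂ) * Complex.I by
        push_cast; ring, Complex.normSq_add_mul_I]
      have := Real.sq_sqrt (show (0 : ℝ) ≤ 3 by norm_num)
      linear_combination t ^ 2 / 4 * this
    rw [this]
    nlinarith [ht.1, ht.2]
  have hcauchy := integral_segment_eq_sub_radial hgc hgd (by norm_num : (-1 : ℝ) ≤ 1) hseg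
  have hside : ∀ t ∈ Set.uIcc (-1 : ℝ) 1, (((1 - t ^ 2) ^ (m + 1) : ℝ) : ℂ) *
      (1 - Complex.I / q * t) ^ (m : ℂ) =
      (((8 / 9) ^ m : ℝ) : ℂ) * g (Complex.I / 2 + q / 2 * t) := by
    intro t ht
    rw [Set.uIcc_of_le (by norm_num)] at ht
    have ht0 : 0 ≤ 1 - t ^ 2 := by nlinarith [ht.1, ht.2]
    have e1 : ((8 / 9 : ℝ) : ℂ) * (1 + Complex.I * (Complex.I / 2 + q / 2 * t) ^ 3) =
        ((1 - t ^ 2 : ℝ) : ℂ) * (1 - Complex.I / q * t) := by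
      rw [show Complex.I / q = Complex.I * q / 3 by field_simp; rw [hq2]]
      push_cast
      linear_combination (1 / 9 : ℂ) * Complex.I_pow_four + q * t / 3 * hI3 +
        t ^ 2 / 3 * (q ^ 2 * Complex.I_sq - hq2) + Complex.I * t ^ 3 / 9 * hq3
    have e2 : 4 / 3 * (1 + Complex.I * (Complex.I / 2 + q / 2 * t) -
        (Complex.I / 2 + q / 2 * t) ^ 2) = ((1 - t ^ 2 : ℝ) : ℂ) := by
      push_cast
      linear_combination (1 / 3 : ℂ) * Complex.I_sq - t ^ 2 / 3 * hq2
    simp only [g]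
    rw [e2, mul_left_comm, ← ofReal_mul_cpow_of_nonneg (by norm_num) _ hm, e1,
      ofReal_mul_cpow_of_nonneg ht0 _ hm, rpow_add_one' ht0 (by linarith)]
    push_cast
    ring
  have hvertex : ∀ p : ℂ, p ^ 3 = Complex.I → ∀ s ∈ Set.uIcc (0 : ℝ) 1, p * g (p * s) =
      (4 / 3 * (p + Complex.I * p ^ 2 * s - p ^ 3 * s ^ 2)) * (((1 - s ^ 3) ^ m : ℝ) : ℂ) := by
    intro p hp s hs
    rw [Set.uIcc_of_le zero_le_one] at hs
    have hs0 : 0 ≤ 1 - s ^ 3 := sub_nonneg.2 (pow_le_one₀ hs.1 hs.2)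
    simp only [g]
    rw [Complex.ofReal_cpow hs0, show 1 + Complex.I * (p * s) ^ 3 = ((1 - s ^ 3 : ℝ) : ℂ) by
      push_cast; linear_combination Complex.I * s ^ 3 * hp + s ^ 3 * Complex.I_sq]
    ring
  have hp1 : (Complex.I / 2 + q / 2 * (1 : ℝ)) ^ 3 = Complex.I := by
    push_cast
    linear_combination (1 / 8 : ℂ) * hI3 + 3 / 8 * q * Complex.I_sq +
      3 / 8 * Complex.I * hq2 + 1 / 8 * hq3
  have hp2 : (Complex.I / 2 + q / 2 * (-1 : ℝ)) ^ 3 = Complex.I := by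
    push_cast
    linear_combination (1 / 8 : ℂ) * hI3 - 3 / 8 * q * Complex.I_sq +
      3 / 8 * Complex.I * hq2 - 1 / 8 * hq3
  have hint : ∀ p : ℂ,
      IntervalIntegrable (fun s : ℝ => (4 / 3 * (p + Complex.I * p ^ 2 * s - p ^ 3 * s ^ 2)) *
        (((1 - s ^ 3) ^ m : ℝ) : ℂ)) MeasureTheory.volume 0 1 := by
    intro p
    have : Continuous fun s : ℝ => (1 - s ^ 3) ^ m :=
      (continuous_rpow_const hm.le).comp (by fun_prop)
    exact Continuous.intervalIntegrable (by fun_prop) _ _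
  rw [intervalIntegral.integral_congr hside, intervalIntegral.integral_const_mul]
  rw [← intervalIntegral.integral_const_mul (Complex.I / 2 + q / 2 * (1 : ℝ)),
    ← intervalIntegral.integral_const_mul (Complex.I / 2 + q / 2 * (-1 : ℝ)),
    intervalIntegral.integral_congr (hvertex _ hp1),
    intervalIntegral.integral_congr (hvertex _ hp2),
    ← intervalIntegral.integral_sub (hint _) (hint _)] at hcauchy
  have hdiff : ∀ s : ℝ, (4 / 3 * ((Complex.I / 2 + q / 2 * (1 : ℝ)) +
        Complex.I * (Complex.I / 2 + q / 2 * (1 : ℝ)) ^ 2 * s -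
        (Complex.I / 2 + q / 2 * (1 : ℝ)) ^ 3 * s ^ 2)) * (((1 - s ^ 3) ^ m : ℝ) : ℂ) -
      (4 / 3 * ((Complex.I / 2 + q / 2 * (-1 : ℝ)) +
        Complex.I * (Complex.I / 2 + q / 2 * (-1 : ℝ)) ^ 2 * s -
        (Complex.I / 2 + q / 2 * (-1 : ℝ)) ^ 3 * s ^ 2)) * (((1 - s ^ 3) ^ m : ℝ) : ℂ) =
      4 / 3 * q * (((1 - s) * (1 - s ^ 3) ^ m : ℝ) : ℂ) := by
    intro s
    rw [hp1, hp2]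
    push_cast
    linear_combination (4 / 3 * q * s * (((1 - s ^ 3) ^ m : ℝ) : ℂ)) * Complex.I_sq
  simp_rw [hdiff] at hcauchy
  rw [intervalIntegral.integral_const_mul, intervalIntegral.integral_ofReal] at hcauchy
  have : ∫ t in (-1 : ℝ)..1, g (Complex.I / 2 + q / 2 * t) =
      8 / 3 * ((∫ s in (0 : ℝ)..1, (1 - s) * (1 - s ^ 3) ^ m : ℝ) : ℂ) := by
    refine mul_left_cancel₀ (div_ne_zero hq0 two_ne_zero) (hcauchy.trans ?_)
    ring
  rw [this]
  push_cast
  ring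

lemma choose_succ_mul_succ (m : ℝ) (n : ℕ) :
    Ring.choose m (n + 1) * (n + 1) = Ring.choose m n * (m - n) := by
  have h1 := Ring.descPochhammer_eq_factorial_smul_choose m (n + 1)
  have h2 := Ring.descPochhammer_eq_factorial_smul_choose m n
  rw [descPochhammer_succ_right, Polynomial.smeval_mul, h2, Nat.factorial_succ] at h1
  simp only [Polynomial.smeval_sub, Polynomial.smeval_X, Polynomial.smeval_natCast, pow_one,
    pow_zero, nsmul_eq_mul, mul_one, Nat.cast_mul, Nat.cast_succ] at h1
  have h0 : (n.factorial : ℝ) ≠ 0 := by positivity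
  apply mul_left_cancel₀ h0
  linear_combination -h1

lemma integral_even_pow_mul_one_sub_sq_rpow {m : ℝ} (hm : 0 < m) (k : ℕ) :
    ∫ x in (-1 : ℝ)..1, x ^ (2 * k) * (1 - x ^ 2) ^ (m + 1) =
      Gamma (k + 1 / 2) * Gamma (m + 2) / Gamma (k + m + 5 / 2) := by
  have hcont : Continuous fun x : ℝ => x ^ (2 * k) * (1 - x ^ 2) ^ (m + 1) :=
    (continuous_pow _).mul (Continuous.rpow_const (by fun_prop) fun _ => Or.inr (by linarith))
  have hneg := intervalIntegral.integral_comp_neg (a := 0) (b := 1)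
    fun x : ℝ => x ^ (2 * k) * (1 - x ^ 2) ^ (m + 1)
  simp only [(even_two_mul k).neg_pow, neg_sq, neg_zero] at hneg
  rw [← intervalIntegral.integral_add_adjacent_intervals (hcont.intervalIntegrable _ 0)
    (hcont.intervalIntegrable _ _), ← hneg]
  have hbeta := integral_rpow_mul_one_sub_rpow (u := k + 1 / 2) (v := m + 2) (p := 2)
    (by positivity) (by positivity) two_pos
  rw [show 2 * ((k : ℝ) + 1 / 2) - 1 = ((2 * k : ℕ) : ℝ) by push_cast; ring,
    show m + 2 - 1 = m + 1 by ring, show (k : ℝ) + 1 / 2 + (m + 2) = k + m + 5 / 2 by ring] at hbeta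
  simp only [rpow_natCast, rpow_ofNat] at hbeta
  rw [hbeta]
  ring

lemma integral_odd_pow_mul_one_sub_sq_rpow (m : ℝ) {n : ℕ} (hn : Odd n) :
    ∫ x in (-1 : ℝ)..1, x ^ n * (1 - x ^ 2) ^ (m + 1) = 0 := by
  have hneg := intervalIntegral.integral_comp_neg (a := -1) (b := 1)
    fun x : ℝ => x ^ n * (1 - x ^ 2) ^ (m + 1)
  simp only [hn.neg_pow, neg_sq, neg_neg, neg_mul, intervalIntegral.integral_neg] at hneg
  linarith

lemma choose_mul_integral_eq_hypTerm {m : ℝ} (hm : 0 < m) (k : ℕ) :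
    Ring.choose m (2 * k) * (-1 / 3) ^ k *
        (Gamma (k + 1 / 2) * Gamma (m + 2) / Gamma (k + m + 5 / 2)) =
      hypTerm (-(m / 2)) k * (Gamma (1 / 2) * Gamma (m + 2) / Gamma (m + 5 / 2)) := by
  induction k with
  | zero => simp [hypTerm_zero]
  | succ k ih =>
    have hk : (0 : ℝ) ≤ k := k.cast_nonneg
    rw [hypTerm_succ _ (fun j h => by have : (0 : ℝ) ≤ j := j.cast_nonneg; linarith),
      mul_assoc _ (hypTerm _ _), ← ih]
    have c1 := choose_succ_mul_succ m (2 * k)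
    have c2 := choose_succ_mul_succ m (2 * k + 1)
    push_cast at c1 c2 ⊢
    rw [show (k : ℝ) + 1 + 1 / 2 = k + 1 / 2 + 1 by ring, Gamma_add_one (by positivity),
      show (k : ℝ) + 1 + m + 5 / 2 = k + m + 5 / 2 + 1 by ring, Gamma_add_one (by positivity),
      show 2 * (k + 1) = 2 * k + 1 + 1 by ring, pow_succ]
    have hg : Gamma (k + m + 5 / 2) ≠ 0 := (Gamma_pos_of_pos (by positivity)).ne'
    have h1 : (k : ℝ) + m + 5 / 2 ≠ 0 := by positivity
    have h3 : (2 * k + 1 : ℝ) ≠ 0 := by positivity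
    have h4 : (2 * k + 1 + 1 : ℝ) ≠ 0 := by positivity
    rw [eq_div_of_mul_eq h4 c2, eq_div_of_mul_eq h3 c1,
      show (5 / 2 : ℝ) - 2 * -(m / 2) + k = k + m + 5 / 2 by ring]
    field_simp
    ring

lemma hasSum_choose_mul_pow (m : ℝ) {v : ℂ} (hv : ‖v‖ < 1) :
    HasSum (fun n : ℕ => ((Ring.choose m n : ℝ) : ℂ) * v ^ n) ((1 + v) ^ (m : ℂ)) := by
  have h := (Complex.one_add_cpow_hasFPowerSeriesOnBall_zero (a := (m : ℂ))).hasSum (y := v)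
    (by rw [← ENNReal.ofReal_one, Metric.eball_ofReal]; simpa using hv)
  simp only [binomialSeries_apply, List.ofFn_const, List.prod_replicate, smul_eq_mul, zero_add] at h
  simpa only [Complex.ofReal_choose] using h

lemma hasSum_integral_one_sub_sq_rpow_mul_cpow {m : ℝ} (hm : 0 < m) :
    HasSum (fun n : ℕ => ((Ring.choose m n : ℝ) : ℂ) * (-(Complex.I / (√3 : ℝ))) ^ n *
        ((∫ x in (-1 : ℝ)..1, x ^ n * (1 - x ^ 2) ^ (m + 1) : ℝ) : ℂ))
      (∫ x in (-1 : ℝ)..1,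
        (((1 - x ^ 2) ^ (m + 1) : ℝ) : ℂ) * (1 - Complex.I / (√3 : ℝ) * x) ^ (m : ℂ)) := by
  have hw : ‖-(Complex.I / (√3 : ℝ))‖ < 1 := by
    rw [norm_neg, norm_div, Complex.norm_I, Complex.norm_real, norm_of_nonneg (sqrt_nonneg _),
      div_lt_one (by positivity)]
    exact lt_sqrt_of_sq_lt (by norm_num)
  set w : ℂ := -(Complex.I / (√3 : ℝ)) with hwdef
  have habs : ∀ x ∈ Set.uIoc (-1 : ℝ) 1, |x| ≤ 1 := fun x hx => by
    rw [Set.uIoc_of_le (by norm_num)] at hx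
    exact abs_le.2 ⟨hx.1.le, hx.2⟩
  have key := intervalIntegral.hasSum_integral_of_dominated_convergence
    (μ := MeasureTheory.volume) (a := (-1 : ℝ)) (b := 1)
    (F := fun (n : ℕ) (x : ℝ) =>
      (((1 - x ^ 2) ^ (m + 1) : ℝ) : ℂ) * (((Ring.choose m n : ℝ) : ℂ) * (w * x) ^ n))
    (f := fun x : ℝ => (((1 - x ^ 2) ^ (m + 1) : ℝ) : ℂ) * (1 + w * x) ^ (m : ℂ))
    (fun n _ => ‖((Ring.choose m n : ℝ) : ℂ) * w ^ n‖) (fun n => ?_) (fun n => ?_) ?_ ?_ ?_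
  · refine (congrArg₂ (HasSum · · _) ?_ ?_).mpr key
    · funext n
      rw [← intervalIntegral.integral_ofReal, ← intervalIntegral.integral_const_mul]
      refine intervalIntegral.integral_congr fun x _ => ?_
      push_cast
      ring
    · refine intervalIntegral.integral_congr fun x _ => ?_
      simp only [hwdef]
      ring_nf
  · have hcont : Continuous fun x : ℝ => (1 - x ^ 2) ^ (m + 1) :=
      Continuous.rpow_const (by fun_prop) fun _ => Or.inr (by linarith)
    exact Continuous.aestronglyMeasurable (by fun_prop)
  · refine Filter.Eventually.of_forall fun x hx => ?_
    have hx1 := habs x hx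
    have hsq : x ^ 2 ≤ 1 := (sq_le_one_iff_abs_le_one x).2 hx1
    rw [mul_pow, ← mul_assoc _ (w ^ n), ← mul_assoc, norm_mul, norm_mul, norm_pow (x : ℂ),
      Complex.norm_real,
      Complex.norm_real, norm_eq_abs x,
      norm_of_nonneg (rpow_nonneg (sub_nonneg.2 hsq) _)]
    refine (mul_le_of_le_one_right (by positivity) (pow_le_one₀ (abs_nonneg x) hx1)).trans ?_
    exact mul_le_of_le_one_left (norm_nonneg _)
      (rpow_le_one (sub_nonneg.2 hsq) (by nlinarith [sq_nonneg x]) (by linarith))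
  · exact Filter.Eventually.of_forall fun x _ => (hasSum_choose_mul_pow m hw).summable.norm
  · exact intervalIntegrable_const
  · refine Filter.Eventually.of_forall fun x hx => ?_
    have hwx : ‖w * x‖ < 1 := by
      rw [norm_mul, Complex.norm_real]
      exact (mul_le_of_le_one_right (norm_nonneg _) (habs x hx)).trans_lt hw
    exact (hasSum_choose_mul_pow m hwx).mul_left _

lemma tsum_hypTerm_mul_eq_integral {m : ℝ} (hm : 0 < m) :
    (((∑' k, hypTerm (-(m / 2)) k) * (Gamma (1 / 2) * Gamma (m + 2) / Gamma (m + 5 / 2)) : ℝ) : ℂ) =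
      ∫ x in (-1 : ℝ)..1,
        (((1 - x ^ 2) ^ (m + 1) : ℝ) : ℂ) * (1 - Complex.I / (√3 : ℝ) * x) ^ (m : ℂ) := by
  have hsum := hasSum_integral_one_sub_sq_rpow_mul_cpow hm
  rw [← (mul_right_injective₀ (two_ne_zero' ℕ)).hasSum_iff] at hsum
  · refine HasSum.unique ?_ hsum
    have hterm := (summable_hypTerm (-(m / 2)) fun j h => by
      have : (0 : ℝ) ≤ j := j.cast_nonneg
      linarith).hasSum.mul_right (Gamma (1 / 2) * Gamma (m + 2) / Gamma (m + 5 / 2))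
    refine (Complex.hasSum_ofReal.2 hterm).congr_fun fun k => ?_
    have hw : (-(Complex.I / (√3 : ℝ))) ^ (2 * k) = (((-1 / 3) ^ k : ℝ) : ℂ) := by
      have h3 : ((√3 : ℝ) : ℂ) ^ 2 = 3 := by
        rw [← Complex.ofReal_pow, sq_sqrt (by norm_num)]; norm_num
      rw [pow_mul, neg_sq, div_pow, Complex.I_sq, h3]
      push_cast
      rfl
    rw [← choose_mul_integral_eq_hypTerm hm, ← integral_even_pow_mul_one_sub_sq_rpow hm,
      Function.comp_apply, hw]
    push_cast
    rfl
  · intro n hn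
    have hodd : Odd n := by
      rw [← Nat.not_even_iff_odd]
      rintro ⟨k, rfl⟩
      exact hn ⟨k, two_mul k⟩
    rw [integral_odd_pow_mul_one_sub_sq_rpow m hodd, Complex.ofReal_zero, mul_zero]

lemma integral_one_sub_mul_one_sub_cube_rpow {m : ℝ} (hm : 0 < m) :
    ∫ s in (0 : ℝ)..1, (1 - s) * (1 - s ^ 3) ^ m =
      1 / 3 * (Gamma (1 / 3) * Gamma (m + 1) / Gamma (m + 4 / 3) -
        Gamma (2 / 3) * Gamma (m + 1) / Gamma (m + 5 / 3)) := by
  have h1 := integral_rpow_mul_one_sub_rpow (u := 1 / 3) (v := m + 1) (p := 3)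
    (by norm_num) (by positivity) three_pos
  have h2 := integral_rpow_mul_one_sub_rpow (u := 2 / 3) (v := m + 1) (p := 3)
    (by norm_num) (by positivity) three_pos
  rw [show (3 : ℝ) * (1 / 3) - 1 = 0 by norm_num, show m + 1 - 1 = m by ring,
    show 1 / 3 + (m + 1) = m + 4 / 3 by ring] at h1
  rw [show (3 : ℝ) * (2 / 3) - 1 = 1 by norm_num, show m + 1 - 1 = m by ring,
    show 2 / 3 + (m + 1) = m + 5 / 3 by ring] at h2
  simp only [rpow_zero, rpow_one, one_mul, rpow_ofNat] at h1 h2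
  have hcont : Continuous fun s : ℝ => (1 - s ^ 3) ^ m :=
    Continuous.rpow_const (by fun_prop) fun _ => Or.inr hm.le
  have hcont' : Continuous fun s : ℝ => s * (1 - s ^ 3) ^ m := continuous_id.mul hcont
  simp only [sub_mul, one_mul]
  rw [intervalIntegral.integral_sub (hcont.intervalIntegrable _ _)
    (hcont'.intervalIntegrable _ _), h1, h2]
  ring

lemma tsum_hypTerm_eq_hypValue_neg_half {m : ℝ} (hm : 0 < m) :
    ∑' k, hypTerm (-(m / 2)) k = hypValue (-(m / 2)) := by
  have hS := (tsum_hypTerm_mul_eq_integral hm).trans (integral_one_sub_sq_rpow_mul_cpow hm)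
  rw [Complex.ofReal_inj, integral_one_sub_mul_one_sub_cube_rpow hm, Gamma_one_half_eq] at hS
  have htri := Gamma_third_mul_Gamma_third_add (s := 4 + 3 * m) (by positivity)
  have hdup := Gamma_mul_Gamma_add_half (m + 2)
  rw [show (4 + 3 * m) / 3 = m + 4 / 3 by ring, show m + 4 / 3 + 1 / 3 = m + 5 / 3 by ring,
    show m + 4 / 3 + 2 / 3 = m + 2 by ring] at htri
  rw [show m + 2 + 1 / 2 = m + 5 / 2 by ring, show 2 * (m + 2) = 4 + 2 * m by ring] at hdup
  have hR : Gamma (m + 2) = (m + 1) * Gamma (m + 1) := by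
    rw [← Gamma_add_one (by positivity)]; ring_nf
  have h53 : Gamma (5 / 3) = 2 / 3 * Gamma (2 / 3) := by
    rw [← Gamma_add_one (by norm_num)]; norm_num
  have h43 : Gamma (4 / 3) = 1 / 3 * Gamma (1 / 3) := by
    rw [← Gamma_add_one (by norm_num)]; norm_num
  have hpow3 : (3 : ℝ) ^ (4 + 3 * m) = 81 * 27 ^ m := by
    rw [rpow_add three_pos, rpow_mul three_pos.le]; norm_num
  have hpow2 : (2 : ℝ) ^ (1 - (4 + 2 * m)) = 1 / (8 * 4 ^ m) := by
    rw [show 1 - (4 + 2 * m) = -3 + -(2 * m) by ring, rpow_add two_pos, rpow_neg two_pos.le,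
      rpow_neg two_pos.le, rpow_mul two_pos.le]
    norm_num
    ring
  have hpow : (8 / 9 : ℝ) ^ m * 27 ^ m = 6 ^ m * 4 ^ m := by
    rw [← mul_rpow (by norm_num) (by norm_num), ← mul_rpow (by norm_num) (by norm_num)]
    norm_num
  rw [hpow3] at htri
  rw [hpow2] at hdup
  rw [hypValue, show -(2 * -(m / 2)) = m by ring, show 1 - 2 * -(m / 2) = m + 1 by ring,
    show 5 / 3 - 2 * -(m / 2) = m + 5 / 3 by ring, show 4 / 3 - 2 * -(m / 2) = m + 4 / 3 by ring,
    show 4 - 4 * -(m / 2) = 4 + 2 * m by ring, show 4 - 6 * -(m / 2) = 4 + 3 * m by ring, h53, h43]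
  have hm1 : m + 1 ≠ 0 := by positivity
  have p1 : Gamma (1 / 3) ≠ 0 := (Gamma_pos_of_pos (by norm_num)).ne'
  have p2 : Gamma (2 / 3) ≠ 0 := (Gamma_pos_of_pos (by norm_num)).ne'
  have p3 : Gamma (m + 4 / 3) ≠ 0 := (Gamma_pos_of_pos (by positivity)).ne'
  have p4 : Gamma (m + 5 / 3) ≠ 0 := (Gamma_pos_of_pos (by positivity)).ne'
  have p5 : Gamma (m + 1) ≠ 0 := (Gamma_pos_of_pos (by positivity)).ne'
  have p6 : Gamma (m + 5 / 2) ≠ 0 := (Gamma_pos_of_pos (by positivity)).ne'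
  have p7 : (27 : ℝ) ^ m ≠ 0 := (rpow_pos_of_pos (by norm_num) _).ne'
  have p8 : (4 : ℝ) ^ m ≠ 0 := (rpow_pos_of_pos (by norm_num) _).ne'
  have p9 : √π ≠ 0 := (sqrt_pos.2 pi_pos).ne'
  have h42 : Gamma (4 + 2 * m) =
      (m + 1) * Gamma (m + 1) * Gamma (m + 5 / 2) * (8 * 4 ^ m) / √π := by
    rw [← hR, hdup]; field_simp
  have h43' : Gamma (4 + 3 * m) = Gamma (m + 4 / 3) * Gamma (m + 5 / 3) *
      ((m + 1) * Gamma (m + 1)) * (27 * 27 ^ m) / (Gamma (1 / 3) * Gamma (2 / 3)) := by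
    rw [← hR, eq_div_iff (mul_ne_zero p1 p2)]; linear_combination -htri / 3
  have h89 : (8 / 9 : ℝ) ^ m = 6 ^ m * 4 ^ m / 27 ^ m := eq_div_of_mul_eq p7 hpow
  rw [hR, h89] at hS
  have p10 : √π * ((m + 1) * Gamma (m + 1)) / Gamma (m + 5 / 2) ≠ 0 := by positivity
  rw [eq_div_of_mul_eq p10 hS, h42, h43']
  field_simp
  ring

/-- The two sides of the summation formula agree for `a < n / 2`. -/
lemma tsum_hypTerm_eq_hypValue_of_lt (n : ℕ) : ∀ a : ℝ, a < n / 2 → a ≠ 1 / 2 →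
    (∀ k : ℕ, (5 / 2 : ℝ) - 2 * a ≠ -(k : ℝ)) → (∀ k : ℕ, (5 / 3 : ℝ) - 2 * a ≠ -(k : ℝ)) →
    (∀ k : ℕ, (4 / 3 : ℝ) - 2 * a ≠ -(k : ℝ)) → (∀ k : ℕ, (4 : ℝ) - 6 * a ≠ -(k : ℝ)) →
    ∑' k, hypTerm a k = hypValue a := by
  induction n with
  | zero =>
    intro a hlt _ _ _ _ _
    have hlt' : a < 0 := by simpa using hlt
    have := tsum_hypTerm_eq_hypValue_neg_half (m := -(2 * a)) (by linarith)
    rwa [show -(-(2 * a) / 2) = a by ring] at this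
  | succ n ih =>
    intro a hlt ha h1 h2 h3 h4
    push_cast at hlt
    have hne1 : a ≠ 1 := fun h => h4 2 (by rw [h]; norm_num)
    have hne32 : a ≠ 3 / 2 := fun h => h4 5 (by rw [h]; norm_num)
    have ihhalf : ∑' k, hypTerm (a - 1 / 2) k = hypValue (a - 1 / 2) := by
      refine ih _ (by linarith) (fun h => hne1 (by linarith)) (fun k h => h1 (k + 1) ?_)
        (fun k h => h2 (k + 1) ?_) (fun k h => h3 (k + 1) ?_) (fun k h => h4 (k + 3) ?_) <;>
      push_cast <;> linarith
    have ihone : ∑' k, hypTerm (a - 1) k = hypValue (a - 1) := by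
      refine ih _ (by linarith) (fun h => hne32 (by linarith)) (fun k h => h1 (k + 2) ?_)
        (fun k h => h2 (k + 2) ?_) (fun k h => h3 (k + 2) ?_) (fun k h => h4 (k + 6) ?_) <;>
      push_cast <;> linarith
    have hS := tsum_hypTerm_contiguous (a - 1) (fun h => hne1 (by linarith))
      (fun h => ha (by linarith)) (fun k h => h1 k (by linarith))
    have hV := hypValue_contiguous (a - 1) (fun h => ha (by linarith))
      (fun h => hne1 (by linarith)) (fun h => hne32 (by linarith)) (fun k h => h1 k (by linarith))
      (fun k h => h2 k (by linarith)) (fun k h => h3 k (by linarith))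
      (fun k h => h4 k (by linarith))
    rw [show a - 1 + 1 = a by ring, show a - 1 + 1 / 2 = a - 1 / 2 by ring] at hS hV
    rw [ihhalf, ihone] at hS
    have hc : 16 * (4 * (a - 1) - 1) * (4 * (a - 1) - 3) * (2 * (a - 1) + 1) ≠ 0 := by
      refine mul_ne_zero (mul_ne_zero (mul_ne_zero (by norm_num) fun h => h1 0 ?_)
        fun h => h1 1 ?_) fun h => ha (by linarith) <;>
      push_cast <;> linarith
    apply mul_left_cancel₀ hc
    linarith

theorem gauss_2F1_special_value_b (a : ℝ) (ha : a ≠ 1 / 2)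
    (h1 : ∀ k : ℕ, (5 / 2 : ℝ) - 2 * a ≠ -(k : ℝ))
    (h2 : ∀ k : ℕ, (5 / 3 : ℝ) - 2 * a ≠ -(k : ℝ))
    (h3 : ∀ k : ℕ, (4 / 3 : ℝ) - 2 * a ≠ -(k : ℝ))
    (h4 : ∀ k : ℕ, (4 : ℝ) - 6 * a ≠ -(k : ℝ)) :
    ∑' k : ℕ, (ascPochhammer ℝ k).eval a * (ascPochhammer ℝ k).eval (a + 1 / 2) /
        ((ascPochhammer ℝ k).eval (5 / 2 - 2 * a) * (Nat.factorial k : ℝ)) *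
        (-1 / 3 : ℝ) ^ k
      = (6 : ℝ) ^ (-(2 * a)) / (1 - 2 * a) *
          (2 * Real.Gamma (5 / 3 - 2 * a) / Real.Gamma (5 / 3) -
            Real.Gamma (4 / 3 - 2 * a) / Real.Gamma (4 / 3)) *
          (Real.Gamma (4 - 4 * a) / Real.Gamma (4 - 6 * a)) := by
  obtain ⟨n, hn⟩ := exists_nat_gt (2 * a)
  exact tsum_hypTerm_eq_hypValue_of_lt n a (by linarith) ha h1 h2 h3 h4
end
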